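/- Assume the time-varying graph G[A(·)] is cut-balanced. Then the protocol ẋ(t) = −L[A(t)]x(t) establishes bipartite consensus (there exist v ∈ ℝ^N \ {0} and ρ ∈ {−1,+1}^N with lim_{t→∞}x(t) = ρ(vᵀx(0)) for every solution) if and only if ℰ⁺ ∩ ℰ⁻ = ∅ and the signed graph 𝒢^± of essential interactions is strongly connected and structurally balanced; in that case opinions polarize (ρ has entries of both signs) if and only if ℰ⁻ ≠ ∅, and otherwise consensus is established (ρ = ±1_N). Moreover, if the graph of essential interactions 𝒢 is strongly connected but either ℰ⁺ ∩ ℰ⁻ ≠ ∅ or 𝒢^± is structurally unbalanced, then every solution converges to 0. -/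

import Mathlib

open MeasureTheory Filter Matrix Finset Topology

/-- The signed Laplacian `L[A]` of a signed adjacency matrix:
off-diagonal entries `L j k = -A j k`, diagonal entries `L j j = ∑ m, |A j m|`. -/
noncomputable def sLap {N : ℕ} (A : Matrix (Fin N) (Fin N) ℝ) : Matrix (Fin N) (Fin N) ℝ :=
  fun j k => if j = k then ∑ m, |A j m| else -A j k

/-- A time-varying signed adjacency matrix: entrywise measurable, locally bounded,
with zero diagonal. -/
def IsAdjacency {N : ℕ} (A : ℝ → Matrix (Fin N) (Fin N) ℝ) : Prop :=
  (∀ j k, Measurable fun t => A t j k) ∧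
  (∀ T : ℝ, ∃ C : ℝ, ∀ t ∈ Set.Icc (0:ℝ) T, ∀ j k, |A t j k| ≤ C) ∧
  (∀ t j, A t j j = 0)

/-- A solution of `ẋ = −L[A(t)]x` on `[0,∞)`: continuous and satisfying the integral
equation (equivalently, locally absolutely continuous and satisfying the ODE a.e.). -/
def IsSolution {N : ℕ} (A : ℝ → Matrix (Fin N) (Fin N) ℝ) (x : ℝ → Fin N → ℝ) : Prop :=
  ContinuousOn x (Set.Ici 0) ∧
  ∀ t ∈ Set.Ici (0:ℝ), ∀ j,
    x t j = x 0 j + ∫ s in (0:ℝ)..t, -((sLap (A s)).mulVec (x s) j)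

/-- Quasi-strong connectivity of the static signed graph `G[A]`: some root reaches
every node along arcs `k → j` present whenever `A j k ≠ 0`. -/
def QSC {N : ℕ} (A : Matrix (Fin N) (Fin N) ℝ) : Prop :=
  ∃ r : Fin N, ∀ j : Fin N, Relation.ReflTransGen (fun k j => A j k ≠ 0) r j

/-- Structural balance of the static signed graph `G[A]`: the nodes split into the camp `S`
and its complement (one possibly empty), with nonnegative weights inside a camp and
nonpositive weights between camps. -/
def StructBal {N : ℕ} (A : Matrix (Fin N) (Fin N) ℝ) : Prop :=
  ∃ S : Set (Fin N), ∀ j k : Fin N,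
    ((j ∈ S ↔ k ∈ S) → 0 ≤ A j k) ∧ (¬(j ∈ S ↔ k ∈ S) → A j k ≤ 0)

/-- `∫_0^∞ |a_{jk}(t)| dt = ∞`: arc `k → j` of the graph of essential interactions. -/
def EssArc {N : ℕ} (A : ℝ → Matrix (Fin N) (Fin N) ℝ) (j k : Fin N) : Prop :=
  ∫⁻ t in Set.Ici (0:ℝ), ENNReal.ofReal |A t j k| = ⊤

/-- `∫_0^∞ a_{jk}⁺(t) dt = ∞`: agents `j` and `k` essentially cooperate. -/
def EssPlus {N : ℕ} (A : ℝ → Matrix (Fin N) (Fin N) ℝ) (j k : Fin N) : Prop :=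
  ∫⁻ t in Set.Ici (0:ℝ), ENNReal.ofReal (max (A t j k) 0) = ⊤

/-- `∫_0^∞ a_{jk}⁻(t) dt = ∞`: agents `j` and `k` essentially compete. -/
def EssMinus {N : ℕ} (A : ℝ → Matrix (Fin N) (Fin N) ℝ) (j k : Fin N) : Prop :=
  ∫⁻ t in Set.Ici (0:ℝ), ENNReal.ofReal (max (-(A t j k)) 0) = ⊤

/-- Reachability from `u` to `v` in the graph of essential interactions. -/
def EssReach {N : ℕ} (A : ℝ → Matrix (Fin N) (Fin N) ℝ) (u v : Fin N) : Prop :=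
  Relation.ReflTransGen (fun k j => EssArc A j k) u v

/-- Uniform strong connectivity of the time-varying graph `G[A(·)]`. -/
def USC {N : ℕ} (A : ℝ → Matrix (Fin N) (Fin N) ℝ) : Prop :=
  ∃ T > (0:ℝ), ∃ ε > (0:ℝ), ∀ t ≥ (0:ℝ), ∀ u v : Fin N,
    Relation.ReflTransGen (fun k j => ε ≤ ∫ s in t..(t + T), |A s j k|) u v

/-- Uniform quasi-strong connectivity of the time-varying graph `G[A(·)]`. -/
def UQSC {N : ℕ} (A : ℝ → Matrix (Fin N) (Fin N) ℝ) : Prop :=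
  ∃ T > (0:ℝ), ∃ ε > (0:ℝ), ∀ t ≥ (0:ℝ), ∃ r : Fin N, ∀ j : Fin N,
    Relation.ReflTransGen (fun k j => ε ≤ ∫ s in t..(t + T), |A s j k|) r j

/-- Cut-balance of the time-varying graph `G[A(·)]` with some constant `K ≥ 1`. -/
def CutBalanced {N : ℕ} (A : ℝ → Matrix (Fin N) (Fin N) ℝ) : Prop :=
  ∃ K : ℝ, 1 ≤ K ∧ ∀ᵐ t ∂(volume.restrict (Set.Ici (0:ℝ))),
    ∀ V : Finset (Fin N), V.Nonempty → V ≠ Finset.univ →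
      K⁻¹ * (∑ j ∈ V, ∑ k ∈ Vᶜ, |A t k j|) ≤ (∑ j ∈ V, ∑ k ∈ Vᶜ, |A t j k|) ∧
      (∑ j ∈ V, ∑ k ∈ Vᶜ, |A t j k|) ≤ K * (∑ j ∈ V, ∑ k ∈ Vᶜ, |A t k j|)

/-- The protocol establishes modulus consensus: the moduli of all opinions converge
to a common limit for every solution. -/
def ModulusConsensus {N : ℕ} (A : ℝ → Matrix (Fin N) (Fin N) ℝ) : Prop :=
  ∀ x : ℝ → Fin N → ℝ, IsSolution A x →
    ∃ c : ℝ, 0 ≤ c ∧ ∀ i, Tendsto (fun t => |x t i|) atTop (𝓝 c)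

/-- The protocol establishes bipartite consensus: there are `v ≠ 0` and `ρ ∈ {±1}^N` such that
every solution converges to `ρ (vᵀ x(0))`. -/
def BipartiteConsensus {N : ℕ} (A : ℝ → Matrix (Fin N) (Fin N) ℝ) : Prop :=
  ∃ v ρ : Fin N → ℝ, v ≠ 0 ∧ (∀ i, ρ i = 1 ∨ ρ i = -1) ∧
    ∀ x : ℝ → Fin N → ℝ, IsSolution A x →
      ∀ i, Tendsto (fun t => x t i) atTop (𝓝 (ρ i * ∑ j, v j * x 0 j))

/-- The essential-interaction signed graph `𝒢^±` is structurally balanced: the camp `S` and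
its complement contain all essentially-cooperating pairs inside a camp and all
essentially-competing pairs between the camps. -/
def EssStructBal {N : ℕ} (A : ℝ → Matrix (Fin N) (Fin N) ℝ) : Prop :=
  ∃ S : Set (Fin N),
    (∀ j k, EssPlus A j k → (j ∈ S ↔ k ∈ S)) ∧
    (∀ j k, EssMinus A j k → ¬(j ∈ S ↔ k ∈ S))

section LinearIntegralEquation

variable {ι : Type*} [Fintype ι]

/-- The Picard increments of the linear integral equation `x = ξ + ∫_T^t M x`. -/
noncomputable def picardTerm (M : ℝ → ι → ι → ℝ) (T : ℝ) (ξ : ι → ℝ) : ℕ → ℝ → ι → ℝ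
  | 0 => fun _ => ξ
  | n + 1 => fun t j => ∫ s in T..t, ∑ k, M s j k * picardTerm M T ξ n s k

theorem continuousOn_Ici_of_Icc {E : Type*} [TopologicalSpace E] {f : ℝ → E} {T : ℝ}
    (h : ∀ b, T ≤ b → ContinuousOn f (Set.Icc 0 b)) : ContinuousOn f (Set.Ici 0) := by
  intro t ht
  have hb := h (max T (t + 1)) (le_max_left _ _) t
    ⟨ht, le_trans (by linarith) (le_max_right T (t + 1))⟩
  refine hb.mono_of_mem_nhdsWithin ?_
  have : Set.Iio (max T (t + 1)) ∈ 𝓝 t :=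
    Iio_mem_nhds (lt_of_lt_of_le (by linarith) (le_max_right T (t + 1)))
  filter_upwards [self_mem_nhdsWithin, mem_nhdsWithin_of_mem_nhds this] with s hs hs'
  exact ⟨hs, le_of_lt hs'⟩

theorem integrableOn_Icc_of_bounded {f : ℝ → ℝ} (hf : Measurable f)
    {b C : ℝ} (hC : ∀ t ∈ Set.Icc 0 b, |f t| ≤ C) : IntegrableOn f (Set.Icc 0 b) := by
  refine Measure.integrableOn_of_bounded (M := C) (by simp) hf.aestronglyMeasurable ?_
  filter_upwards [ae_restrict_mem measurableSet_Icc] with t ht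
  exact hC t ht

variable {M : ℝ → ι → ι → ℝ}

theorem integrableOn_sum_mul
    (hM : ∀ j k, Measurable fun t => M t j k)
    (hb : ∀ T : ℝ, ∃ C, ∀ t ∈ Set.Icc 0 T, ∀ j k, |M t j k| ≤ C)
    {x : ℝ → ι → ℝ} {b : ℝ}
    (hx : ∀ k, ContinuousOn (fun t => x t k) (Set.Icc 0 b)) (j : ι) :
    IntegrableOn (fun s => ∑ k, M s j k * x s k) (Set.Icc 0 b) := by
  obtain ⟨C, hC⟩ := hb b
  refine integrable_finsetSum _ fun k _ => ?_
  exact (integrableOn_Icc_of_bounded (hM j k) fun t ht => hC t ht j k).mul_continuousOn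
    (hx k) isCompact_Icc

theorem intervalIntegrable_sum_mul
    (hM : ∀ j k, Measurable fun t => M t j k)
    (hb : ∀ T : ℝ, ∃ C, ∀ t ∈ Set.Icc 0 T, ∀ j k, |M t j k| ≤ C)
    {x : ℝ → ι → ℝ}
    (hx : ∀ k, ContinuousOn (fun t => x t k) (Set.Ici 0)) (j : ι) {s t : ℝ}
    (hs : 0 ≤ s) (ht : 0 ≤ t) :
    IntervalIntegrable (fun s => ∑ k, M s j k * x s k) volume s t := by
  rw [intervalIntegrable_iff]
  refine (integrableOn_sum_mul hM hb (b := max s t)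
    (fun k => (hx k).mono Set.Icc_subset_Ici_self) j).mono_set ?_
  rw [Set.uIoc_eq_union]
  rintro u (⟨h1, h2⟩ | ⟨h1, h2⟩)
  · exact ⟨by linarith, h2.trans (le_max_right _ _)⟩
  · exact ⟨by linarith, h2.trans (le_max_left _ _)⟩

theorem continuousOn_integral_sum_mul
    (hM : ∀ j k, Measurable fun t => M t j k)
    (hb : ∀ T : ℝ, ∃ C, ∀ t ∈ Set.Icc 0 T, ∀ j k, |M t j k| ≤ C)
    {x : ℝ → ι → ℝ}
    (hx : ∀ k, ContinuousOn (fun t => x t k) (Set.Ici 0)) (j : ι) {T : ℝ} (hT : 0 ≤ T) :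
    ContinuousOn (fun t => ∫ s in T..t, ∑ k, M s j k * x s k) (Set.Ici 0) := by
  refine continuousOn_Ici_of_Icc (T := T) fun b hTb => ?_
  have := intervalIntegral.continuousOn_primitive_interval' (a := T)
    (intervalIntegrable_sum_mul hM hb hx j le_rfl (hT.trans hTb))
    (by rw [Set.uIcc_of_le (hT.trans hTb)]; exact ⟨hT, hTb⟩)
  rwa [Set.uIcc_of_le (hT.trans hTb)] at this

theorem continuousOn_picardTerm
    (hM : ∀ j k, Measurable fun t => M t j k)
    (hb : ∀ T : ℝ, ∃ C, ∀ t ∈ Set.Icc 0 T, ∀ j k, |M t j k| ≤ C)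
    {T : ℝ} (hT : 0 ≤ T) (ξ : ι → ℝ) (n : ℕ) (j : ι) :
    ContinuousOn (fun t => picardTerm M T ξ n t j) (Set.Ici 0) := by
  induction n generalizing j with
  | zero => exact continuousOn_const
  | succ n ih => exact continuousOn_integral_sum_mul hM hb ih j hT

theorem abs_picardTerm_le {T b C X : ℝ} (hT : 0 ≤ T) (hTb : T ≤ b) (hC0 : 0 ≤ C)
    (hC : ∀ t ∈ Set.Icc 0 b, ∀ j k, |M t j k| ≤ C) (ξ : ι → ℝ) (hX : ∀ j, |ξ j| ≤ X)
    (n : ℕ) : ∀ t ∈ Set.Icc 0 b, ∀ j,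
      |picardTerm M T ξ n t j| ≤ X * ((Fintype.card ι * C) ^ n * |t - T| ^ n / n.factorial) := by
  induction n with
  | zero => intro t _ j; simpa [picardTerm] using hX j
  | succ n ih =>
    intro t ht j
    have hX0 : 0 ≤ X := (abs_nonneg _).trans (hX j)
    have hsub : Set.uIoc T t ⊆ Set.Icc 0 b := by
      rw [Set.uIoc_eq_union]
      rintro u (⟨h1, h2⟩ | ⟨h1, h2⟩)
      · exact ⟨by linarith, by linarith [ht.2]⟩
      · exact ⟨by linarith [ht.1], by linarith⟩
    set D : ℝ := X * ((Fintype.card ι * C) ^ (n + 1) / n.factorial) with hD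
    have hpt : ∀ s ∈ Set.uIoc T t,
        ‖∑ k, M s j k * picardTerm M T ξ n s k‖ ≤ D * |s - T| ^ n := by
      intro s hs
      have hs' := hsub hs
      calc ‖∑ k, M s j k * picardTerm M T ξ n s k‖
          ≤ ∑ k, ‖M s j k * picardTerm M T ξ n s k‖ := norm_sum_le _ _
        _ ≤ ∑ _k : ι, C * (X * ((Fintype.card ι * C) ^ n * |s - T| ^ n / n.factorial)) := by
            refine Finset.sum_le_sum fun k _ => ?_
            rw [norm_mul]
            exact mul_le_mul (hC s hs' j k) (ih s hs' k) (abs_nonneg _) hC0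
        _ = D * |s - T| ^ n := by
            rw [Finset.sum_const, Finset.card_univ, nsmul_eq_mul, hD]; ring
    have hint : IntegrableOn (fun s => D * |s - T| ^ n) (Set.uIoc T t) := by
      have : Continuous fun s : ℝ => D * |s - T| ^ n := by fun_prop
      exact (this.intervalIntegrable T t).def'
    calc |picardTerm M T ξ (n + 1) t j|
        = ‖∫ s in T..t, ∑ k, M s j k * picardTerm M T ξ n s k‖ := rfl
      _ ≤ ∫ s in Set.uIoc T t, ‖∑ k, M s j k * picardTerm M T ξ n s k‖ :=
          intervalIntegral.norm_integral_le_integral_norm_uIoc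
      _ ≤ ∫ s in Set.uIoc T t, D * |s - T| ^ n := by
          refine integral_mono_of_nonneg (ae_of_all _ fun s => norm_nonneg _) hint ?_
          filter_upwards [ae_restrict_mem measurableSet_uIoc] with s hs using hpt s hs
      _ = X * ((Fintype.card ι * C) ^ (n + 1) * |t - T| ^ (n + 1) / (n + 1).factorial) := by
          rw [integral_const_mul, integral_pow_abs_sub_uIoc, hD, Nat.factorial_succ]
          push_cast
          field_simp

/-- Carathéodory solutions of a linear system with measurable, locally bounded coefficients
exist on `[0,∞)`, with the value prescribed at an arbitrary time. -/
theorem exists_linear_integral_eq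
    (hM : ∀ j k, Measurable fun t => M t j k)
    (hb : ∀ T : ℝ, ∃ C, ∀ t ∈ Set.Icc 0 T, ∀ j k, |M t j k| ≤ C)
    {T : ℝ} (hT : 0 ≤ T) (ξ : ι → ℝ) :
    ∃ x : ℝ → ι → ℝ, (∀ j, ContinuousOn (fun t => x t j) (Set.Ici 0)) ∧
      ∀ t ∈ Set.Ici (0:ℝ), ∀ j, x t j = ξ j + ∫ s in T..t, ∑ k, M s j k * x s k := by
  set d := picardTerm M T ξ with hd
  have hbound : ∀ b, T ≤ b → ∃ C : ℝ, 0 ≤ C ∧ (∀ t ∈ Set.Icc 0 b, ∀ j k, |M t j k| ≤ C) ∧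
      ∃ u : ℕ → ℝ, Summable u ∧ ∀ n, ∀ t ∈ Set.Icc 0 b, ∀ j, |d n t j| ≤ u n := by
    intro b hTb
    obtain ⟨C, hC⟩ := hb b
    have hC' : ∀ t ∈ Set.Icc 0 b, ∀ j k, |M t j k| ≤ max C 0 :=
      fun t ht j k => (hC t ht j k).trans (le_max_left _ _)
    have hb0 : 0 ≤ b := hT.trans hTb
    have hX : ∀ j, |ξ j| ≤ ∑ i, |ξ i| := fun j =>
      Finset.single_le_sum (f := fun i => |ξ i|) (fun i _ => abs_nonneg _) (Finset.mem_univ j)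
    refine ⟨max C 0, le_max_right _ _, hC',
      fun n => (∑ i, |ξ i|) * ((Fintype.card ι * max C 0 * b) ^ n / n.factorial),
      (Real.summable_pow_div_factorial _).mul_left _, fun n t ht j => ?_⟩
    refine (abs_picardTerm_le hT hTb (le_max_right _ _) hC' ξ hX n t ht j).trans ?_
    have : |t - T| ≤ b := by rw [abs_le]; constructor <;> linarith [ht.1, ht.2]
    simp only [mul_pow _ b]
    have h0 : (0:ℝ) ≤ max C 0 := le_max_right _ _
    have h1 : 0 ≤ ∑ i, |ξ i| := Finset.sum_nonneg fun i _ => abs_nonneg _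
    gcongr
  have hsum : ∀ t ∈ Set.Ici (0:ℝ), ∀ j, Summable fun n => d n t j := by
    intro t ht j
    obtain ⟨C, -, -, u, hu, hdu⟩ := hbound (max T t) (le_max_left _ _)
    exact Summable.of_norm_bounded hu fun n => hdu n t ⟨ht, le_max_right _ _⟩ j
  refine ⟨fun t j => ∑' n, d n t j, fun j => ?_, fun t ht j => ?_⟩
  · refine continuousOn_Ici_of_Icc (T := T) fun b hTb => ?_
    obtain ⟨C, -, -, u, hu, hdu⟩ := hbound b hTb
    exact continuousOn_tsum
      (fun n => (continuousOn_picardTerm hM hb hT ξ n j).mono Set.Icc_subset_Ici_self) hu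
      fun n t ht => hdu n t ht j
  · obtain ⟨C, hC0, hC, u, hu, hdu⟩ := hbound (max T t) (le_max_left _ _)
    have hsub : Set.uIoc T t ⊆ Set.Icc 0 (max T t) := by
      rw [Set.uIoc_eq_union]
      rintro s (⟨h1, h2⟩ | ⟨h1, h2⟩)
      · exact ⟨by linarith, h2.trans (le_max_right _ _)⟩
      · exact ⟨by linarith [Set.mem_Ici.1 ht], h2.trans (le_max_left _ _)⟩
    have key : HasSum (fun n => ∫ s in T..t, ∑ k, M s j k * d n s k)
        (∫ s in T..t, ∑ k, M s j k * ∑' n, d n s k) := by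
      refine intervalIntegral.hasSum_integral_of_dominated_convergence
        (fun n _ => ∑ _k : ι, C * u n) (fun n => ?_) (fun n => ?_) ?_ ?_ ?_
      · exact (intervalIntegrable_sum_mul hM hb (continuousOn_picardTerm hM hb hT ξ n) j hT
          ht).def'.aestronglyMeasurable
      · refine ae_of_all _ fun s hs => (norm_sum_le _ _).trans (Finset.sum_le_sum fun k _ => ?_)
        rw [norm_mul]
        exact mul_le_mul (hC s (hsub hs) j k) (hdu n s (hsub hs) k) (abs_nonneg _) hC0
      · exact ae_of_all _ fun s _ => summable_sum fun k _ => hu.mul_left C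
      · exact intervalIntegrable_const
      · refine ae_of_all _ fun s hs => hasSum_sum fun k _ => ?_
        exact (hsum s (hsub hs).1 k).hasSum.mul_left _
    beta_reduce
    rw [← key.tsum_eq, (hsum t ht j).tsum_eq_zero_add]
    rfl

end LinearIntegralEquation

section Solutions

variable {N : ℕ}

theorem neg_sLap_mulVec {A : Matrix (Fin N) (Fin N) ℝ} (hA : ∀ j, A j j = 0) (x : Fin N → ℝ)
    (i : Fin N) :
    -((sLap A).mulVec x i) = ∑ k, (A i k * x k - |A i k| * x i) := by
  have h : ∀ k, sLap A i k * x k = (if i = k then (∑ m, |A i m|) * x i else 0) - A i k * x k := by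
    intro k
    unfold sLap
    split_ifs with hik
    · subst hik; rw [hA]; ring
    · ring
  simp only [Matrix.mulVec, dotProduct, h, Finset.sum_sub_distrib, Finset.sum_ite_eq,
    Finset.mem_univ, if_true, ← Finset.sum_mul]
  ring

variable {A : ℝ → Matrix (Fin N) (Fin N) ℝ}

theorem measurable_sLap (hA : IsAdjacency A) (j k : Fin N) :
    Measurable fun t => -sLap (A t) j k := by
  unfold sLap
  by_cases h : j = k
  · simp only [h, if_true]
    exact (Finset.measurable_fun_sum _ fun m _ => (hA.1 k m).abs).neg
  · simp only [h, if_false, neg_neg]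
    exact hA.1 j k

theorem sLap_bounded (hA : IsAdjacency A) (T : ℝ) :
    ∃ C, ∀ t ∈ Set.Icc 0 T, ∀ j k, |-sLap (A t) j k| ≤ C := by
  obtain ⟨C, hC⟩ := hA.2.1 T
  refine ⟨N * max C 0 + max C 0, fun t ht j k => ?_⟩
  have h0 : 0 ≤ max C 0 := le_max_right _ _
  have hC' : ∀ j k, |A t j k| ≤ max C 0 := fun j k => (hC t ht j k).trans (le_max_left _ _)
  unfold sLap
  split_ifs with h
  · rw [abs_neg, abs_of_nonneg (Finset.sum_nonneg fun _ _ => abs_nonneg _)]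
    calc ∑ m, |A t j m| ≤ ∑ _m : Fin N, max C 0 := Finset.sum_le_sum fun m _ => hC' j m
      _ = N * max C 0 := by simp
      _ ≤ _ := by linarith
  · rw [neg_neg]
    have : 0 ≤ N * max C 0 := by positivity
    linarith [hC' j k]

theorem neg_mulVec_eq_sum (A : Matrix (Fin N) (Fin N) ℝ) (x : Fin N → ℝ) (j : Fin N) :
    -((sLap A).mulVec x j) = ∑ k, -sLap A j k * x k := by
  simp [Matrix.mulVec, dotProduct]

theorem exists_isSolution (hA : IsAdjacency A) {T : ℝ} (hT : 0 ≤ T) (ξ : Fin N → ℝ) :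
    ∃ x, IsSolution A x ∧ x T = ξ := by
  obtain ⟨x, hxc, hx⟩ := exists_linear_integral_eq (measurable_sLap hA) (sLap_bounded hA) hT ξ
  refine ⟨x, ⟨continuousOn_pi.2 hxc, fun t ht j => ?_⟩, ?_⟩
  · have hi := fun s (hs : 0 ≤ s) t (ht : 0 ≤ t) =>
      intervalIntegrable_sum_mul (measurable_sLap hA) (sLap_bounded hA) hxc j hs ht
    simp only [neg_mulVec_eq_sum]
    rw [hx t ht, hx 0 Set.self_mem_Ici,
      ← intervalIntegral.integral_add_adjacent_intervals (hi T hT 0 le_rfl) (hi 0 le_rfl t ht)]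
    ring
  · funext j
    rw [hx T hT j]; simp

namespace IsSolution

variable {x y : ℝ → Fin N → ℝ}

theorem continuousOn_apply (hx : IsSolution A x) (j : Fin N) :
    ContinuousOn (fun t => x t j) (Set.Ici 0) :=
  continuousOn_pi.1 hx.1 j

theorem intervalIntegrable (hA : IsAdjacency A) (hx : IsSolution A x) (j : Fin N) {s t : ℝ}
    (hs : 0 ≤ s) (ht : 0 ≤ t) :
    IntervalIntegrable (fun s => -((sLap (A s)).mulVec (x s) j)) volume s t := by
  simp only [neg_mulVec_eq_sum]
  exact intervalIntegrable_sum_mul (measurable_sLap hA) (sLap_bounded hA) hx.continuousOn_apply j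
    hs ht

protected theorem add (hA : IsAdjacency A) (hx : IsSolution A x) (hy : IsSolution A y) :
    IsSolution A (x + y) := by
  refine ⟨hx.1.add hy.1, fun t ht j => ?_⟩
  simp only [Pi.add_apply, Matrix.mulVec_add, neg_add]
  rw [intervalIntegral.integral_add (hx.intervalIntegrable hA j le_rfl ht)
    (hy.intervalIntegrable hA j le_rfl ht), hx.2 t ht j, hy.2 t ht j]
  ring

protected theorem const_smul (c : ℝ) (hx : IsSolution A x) : IsSolution A (c • x) := by
  refine ⟨hx.1.const_smul c, fun t ht j => ?_⟩
  simp only [Pi.smul_apply, Matrix.mulVec_smul, smul_eq_mul, ← mul_neg]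
  rw [intervalIntegral.integral_const_mul, hx.2 t ht j]
  ring

protected theorem zero : IsSolution A 0 :=
  ⟨continuousOn_const, fun t _ j => by simp⟩

protected theorem sub (hA : IsAdjacency A) (hx : IsSolution A x) (hy : IsSolution A y) :
    IsSolution A (x - y) := by
  simpa [sub_eq_add_neg] using hx.add hA (hy.const_smul (-1))

protected theorem sum (hA : IsAdjacency A) {ι : Type*} (s : Finset ι) {z : ι → ℝ → Fin N → ℝ}
    (hz : ∀ i ∈ s, IsSolution A (z i)) : IsSolution A (∑ i ∈ s, z i) :=
  Finset.sum_induction _ _ (fun _ _ h1 h2 => h1.add hA h2) IsSolution.zero hz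

theorem lipschitzOnWith (hA : IsAdjacency A) (hx : IsSolution A x) (b : ℝ) :
    ∃ K : NNReal, ∀ i, LipschitzOnWith K (fun t => x t i) (Set.Icc 0 b) := by
  obtain ⟨C, hC⟩ := sLap_bounded hA b
  obtain ⟨X, hX⟩ := isCompact_Icc.exists_bound_of_continuousOn
    (hx.1.mono (Set.Icc_subset_Ici_self : Set.Icc 0 b ⊆ Set.Ici 0))
  have hC0 : ∀ t ∈ Set.Icc 0 b, ∀ j k, |-sLap (A t) j k| ≤ max C 0 :=
    fun t ht j k => (hC t ht j k).trans (le_max_left _ _)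
  refine ⟨Real.toNNReal (N * (max C 0 * X)), fun i => LipschitzOnWith.of_dist_le_mul ?_⟩
  intro s hs t ht
  have hint := fun u (hu : u ∈ Set.Icc 0 b) => hx.intervalIntegrable hA i le_rfl hu.1
  rw [Real.dist_eq, Real.dist_eq, hx.2 s hs.1 i, hx.2 t ht.1 i, add_sub_add_left_eq_sub,
    intervalIntegral.integral_interval_sub_left (hint s hs) (hint t ht), ← Real.norm_eq_abs]
  refine intervalIntegral.norm_integral_le_of_norm_le_const fun u hu => ?_
  have hu' : u ∈ Set.Icc 0 b := by
    rw [Set.uIoc_eq_union] at hu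
    rcases hu with ⟨h1, h2⟩ | ⟨h1, h2⟩
    · exact ⟨by linarith [ht.1], by linarith [hs.2]⟩
    · exact ⟨by linarith [hs.1], by linarith [ht.2]⟩
  rw [neg_mulVec_eq_sum]
  refine le_trans ?_ (Real.le_coe_toNNReal _)
  calc ‖∑ k, -sLap (A u) i k * x u k‖ ≤ ∑ k, ‖-sLap (A u) i k * x u k‖ := norm_sum_le _ _
    _ ≤ ∑ _k : Fin N, max C 0 * X := by
        refine Finset.sum_le_sum fun k _ => ?_
        rw [norm_mul]
        exact mul_le_mul (hC0 u hu' i k) ((norm_le_pi_norm _ k).trans (hX u hu')) (norm_nonneg _)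
          (le_max_right _ _)
    _ = N * (max C 0 * X) := by simp

theorem ae_hasDerivAt (hA : IsAdjacency A) (hx : IsSolution A x) :
    ∀ᵐ t, 0 < t → ∀ i,
      HasDerivAt (fun t => x t i) (∑ k, (A t i k * x t k - |A t i k| * x t i)) t := by
  have h : ∀ n : ℕ, ∀ i, ∀ᵐ t, t ∈ Set.uIcc (0:ℝ) n → ∀ c ∈ Set.uIcc (0:ℝ) n,
      HasDerivAt (fun t => ∫ s in c..t, -((sLap (A s)).mulVec (x s) i))
        (-((sLap (A t)).mulVec (x t) i)) t := fun n i =>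
    (hx.intervalIntegrable hA i le_rfl n.cast_nonneg).ae_hasDerivAt_integral
  simp only [← ae_all_iff] at h
  filter_upwards [h] with t ht h0 i
  obtain ⟨n, hn⟩ := exists_nat_ge t
  have h1 := ht n i (by rw [Set.uIcc_of_le n.cast_nonneg]; exact ⟨h0.le, hn⟩) 0
    Set.left_mem_uIcc
  rw [← neg_sLap_mulVec (hA.2.2 t)]
  refine (h1.const_add (x 0 i)).congr_of_eventuallyEq ?_
  filter_upwards [Ioi_mem_nhds h0] with s hs
  exact hx.2 s (Set.mem_Ici.2 (le_of_lt hs)) i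

end IsSolution

end Solutions

section MaximumPrinciple

theorem LipschitzOnWith.finset_sup' {ι : Type*} {s : Finset ι} (hs : s.Nonempty)
    {f : ι → ℝ → ℝ} {u : Set ℝ} {K : NNReal} (hf : ∀ i ∈ s, LipschitzOnWith K (f i) u) :
    LipschitzOnWith K (fun t => s.sup' hs fun i => f i t) u := by
  refine LipschitzOnWith.of_le_add_mul K fun x hx y hy => Finset.sup'_le hs _ fun i hi => ?_
  exact ((hf i hi).le_add_mul hx hy).trans
    (add_le_add_left (Finset.le_sup' (fun i => f i y) hi) _)

/-- If the derivative of each function attaining the maximum of a finite family is at most `h`,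
the maximum grows at most by the integral of `h`. -/
theorem le_add_integral_of_deriv_le_of_isMax {ι : Type*} {s : Finset ι} (hs : s.Nonempty)
    {f : ι → ℝ → ℝ} {a b m : ℝ} (hab : a ≤ b) {K : NNReal}
    (hf : ∀ i ∈ s, LipschitzOnWith K (f i) (Set.Icc a b)) {h : ℝ → ℝ}
    (hh : IntervalIntegrable h volume a b)
    (hd : ∀ᵐ t, t ∈ Set.Ioo a b → ∀ i ∈ s, (∀ j ∈ s, f j t ≤ f i t) → deriv (f i) t ≤ h t)
    (hm : ∀ i ∈ s, f i a ≤ m) {i : ι} (hi : i ∈ s) :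
    f i b ≤ m + ∫ t in a..b, h t := by
  set g : ℝ → ℝ := fun t => s.sup' hs fun i => f i t with hg
  have hac : ∀ {φ : ℝ → ℝ}, LipschitzOnWith K φ (Set.Icc a b) →
      AbsolutelyContinuousOnInterval φ a b := fun hφ =>
    LipschitzOnWith.absolutelyContinuousOnInterval (by rwa [Set.uIcc_of_le hab])
  have hgac := hac (LipschitzOnWith.finset_sup' hs hf)
  have hfd : ∀ᵐ t, ∀ i : s, t ∈ Set.uIcc a b → DifferentiableAt ℝ (f i) t := by
    rw [ae_all_iff]
    exact fun i => (hac (hf i i.2)).ae_differentiableAt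
  have hle : ∀ᵐ t ∂volume.restrict (Set.Icc a b), deriv g t ≤ h t := by
    rw [← Measure.restrict_congr_set Ioo_ae_eq_Icc]
    rw [ae_restrict_iff' measurableSet_Ioo]
    filter_upwards [hd, hfd, hgac.ae_differentiableAt] with t h1 h2 h3 ht
    have htu : t ∈ Set.uIcc a b := by rw [Set.uIcc_of_le hab]; exact Set.Ioo_subset_Icc_self ht
    obtain ⟨k, hk, hkt⟩ := Finset.exists_mem_eq_sup' hs fun i => f i t
    have hmin : IsLocalMin (fun u => g u - f k u) t := by
      refine Eventually.of_forall fun u => ?_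
      have : f k u ≤ g u := Finset.le_sup' (fun i => f i u) hk
      have h5 : g t = f k t := hkt
      simp only [h5]; linarith
    have h4 := hmin.deriv_eq_zero
    have h6 : deriv (fun u => g u - f k u) t = deriv g t - deriv (f k) t :=
      deriv_fun_sub (h3 htu) (h2 ⟨k, hk⟩ htu)
    rw [h6] at h4
    have := h1 ht k hk fun j hj => hkt ▸ Finset.le_sup' (fun i => f i t) hj
    linarith
  have hint := intervalIntegral.integral_mono_ae_restrict hab hgac.intervalIntegrable_deriv hh hle
  rw [hgac.integral_deriv_eq_sub] at hint
  have h1 : f i b ≤ g b := Finset.le_sup' (fun i => f i b) hi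
  have h2 : g a ≤ m := Finset.sup'_le hs _ hm
  linarith

end MaximumPrinciple

section CutBalance

variable {N : ℕ} {B : Fin N → Fin N → ℝ} {K : ℝ}

theorem sum_weight_mul_indicator_le (hB : ∀ i j, 0 ≤ B i j) (hK : 1 ≤ K) {V : Finset (Fin N)}
    (hcut : ∑ j ∈ V, ∑ k ∈ Vᶜ, B k j ≤ K * ∑ j ∈ V, ∑ k ∈ Vᶜ, B j k)
    {w : Fin N → ℝ} {a : ℝ} (ha : 0 ≤ a) (hwV : ∀ i ∈ V, a ≤ w i)
    (hwc : ∀ i, i ∉ V → w i ≤ a / (2 * K)) :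
    ∑ i, w i * ∑ j, B i j * ((if j ∈ V then 1 else 0) - (if i ∈ V then 1 else 0)) ≤
      -(a / (2 * (1 + K))) *
        ∑ i, ∑ j, B i j * |(if i ∈ V then (1:ℝ) else 0) - (if j ∈ V then 1 else 0)| := by
  set In := ∑ j ∈ V, ∑ k ∈ Vᶜ, B k j with hIn
  set Out := ∑ j ∈ V, ∑ k ∈ Vᶜ, B j k with hOut
  have hIn' : In = ∑ i, ∑ j, if i ∉ V ∧ j ∈ V then B i j else 0 := by
    rw [hIn, Finset.sum_comm, ← Finset.sum_filter_add_sum_filter_not Finset.univ (· ∉ V)]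
    simp only [not_not]
    rw [Finset.sum_eq_zero (s := Finset.univ.filter (· ∈ V)), add_zero]
    · have : (Finset.univ.filter (· ∉ V)) = Vᶜ := by ext; simp
      rw [this]
      refine Finset.sum_congr rfl fun i hi => ?_
      rw [← Finset.sum_filter]
      refine Finset.sum_congr ?_ fun _ _ => rfl
      ext j; simp [Finset.mem_compl.1 hi]
    · intro i hi
      refine Finset.sum_eq_zero fun j _ => ?_
      simp [(Finset.mem_filter.1 hi).2]
  have hOut' : Out = ∑ i, ∑ j, if i ∈ V ∧ j ∉ V then B i j else 0 := by
    rw [hOut, ← Finset.sum_filter_add_sum_filter_not Finset.univ (· ∈ V)]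
    rw [Finset.sum_eq_zero (s := Finset.univ.filter (¬ · ∈ V)), add_zero]
    · have : (Finset.univ.filter (· ∈ V)) = V := by ext; simp
      rw [this]
      refine Finset.sum_congr rfl fun i hi => ?_
      rw [← Finset.sum_filter]
      refine Finset.sum_congr ?_ fun _ _ => rfl
      ext j; simp [hi]
    · intro i hi
      refine Finset.sum_eq_zero fun j _ => ?_
      simp [(Finset.mem_filter.1 hi).2]
  have h1 : ∑ i, w i * ∑ j, B i j * ((if j ∈ V then 1 else 0) - (if i ∈ V then 1 else 0)) ≤
      a / (2 * K) * In - a * Out := by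
    rw [hIn', hOut', Finset.mul_sum, Finset.mul_sum, ← Finset.sum_sub_distrib]
    refine Finset.sum_le_sum fun i _ => ?_
    rw [Finset.mul_sum, Finset.mul_sum, Finset.mul_sum, ← Finset.sum_sub_distrib]
    refine Finset.sum_le_sum fun j _ => ?_
    by_cases hi : i ∈ V <;> by_cases hj : j ∈ V <;> simp [hi, hj]
    · exact mul_le_mul_of_nonneg_right (hwV i hi) (hB i j)
    · exact mul_le_mul_of_nonneg_right (hwc i hi) (hB i j)
  have h2 : ∑ i, ∑ j, B i j * |(if i ∈ V then (1:ℝ) else 0) - (if j ∈ V then 1 else 0)| =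
      In + Out := by
    rw [hIn', hOut', ← Finset.sum_add_distrib]
    refine Finset.sum_congr rfl fun i _ => ?_
    rw [← Finset.sum_add_distrib]
    refine Finset.sum_congr rfl fun j _ => ?_
    by_cases hi : i ∈ V <;> by_cases hj : j ∈ V <;> simp [hi, hj]
  rw [h2]
  refine h1.trans ?_
  have h3 : a / (2 * K) * In ≤ a / 2 * Out := by
    calc a / (2 * K) * In ≤ a / (2 * K) * (K * Out) := by gcongr
      _ = a / 2 * Out := by field_simp
  have h4 : a / (2 * (1 + K)) * (In + Out) ≤ a / 2 * Out := by
    calc a / (2 * (1 + K)) * (In + Out) ≤ a / (2 * (1 + K)) * ((1 + K) * Out) := by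
          gcongr; linarith
      _ = a / 2 * Out := by field_simp
  linarith

/-- A nonnegative vector sorted by `π` is a nonnegative combination of indicators of the
initial segments of `π`. -/
theorem exists_layer_decomposition {y : Fin N → ℝ} (hy : ∀ i, 0 ≤ y i)
    {π : Equiv.Perm (Fin N)} (hπ : ∀ i j, y j < y i → π i < π j) :
    ∃ g : ℕ → ℝ, (∀ l, 0 ≤ g l) ∧
      ∀ i, y i = ∑ l ∈ Finset.range N, g l * (if (π i : ℕ) ≤ l then 1 else 0) := by
  set Y : ℕ → ℝ := fun l => if h : l < N then y (π.symm ⟨l, h⟩) else 0 with hY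
  have hanti : ∀ l, Y (l + 1) ≤ Y l := by
    intro l
    simp only [hY]
    by_cases h1 : l + 1 < N
    · have h2 : l < N := by omega
      rw [dif_pos h1, dif_pos h2]
      by_contra! hlt
      have := hπ _ _ hlt
      simp at this
    · rw [dif_neg h1]
      split_ifs
      · exact hy _
      · exact le_rfl
  refine ⟨fun l => Y l - Y (l + 1), fun l => sub_nonneg.2 (hanti l), fun i => ?_⟩
  have h1 : ∀ n, (π i : ℕ) ≤ n →
      ∑ l ∈ Finset.range n, (Y l - Y (l + 1)) * (if (π i : ℕ) ≤ l then 1 else 0) =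
        Y (π i) - Y n := by
    intro n hn
    induction n, hn using Nat.le_induction with
    | base =>
      rw [sub_self]
      refine Finset.sum_eq_zero fun l hl => ?_
      rw [if_neg (by simpa using Finset.mem_range.1 hl), mul_zero]
    | succ n hn ih => rw [Finset.sum_range_succ, ih, if_pos hn]; ring
  rw [h1 N (π i).2.le]
  simp [hY]

theorem sum_weight_mul_diff_le (hB : ∀ i j, 0 ≤ B i j) (hK : 1 ≤ K)
    (hcut : ∀ V : Finset (Fin N), V.Nonempty → V ≠ Finset.univ →
      ∑ j ∈ V, ∑ k ∈ Vᶜ, B k j ≤ K * ∑ j ∈ V, ∑ k ∈ Vᶜ, B j k)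
    {y : Fin N → ℝ} (hy : ∀ i, 0 ≤ y i) {π : Equiv.Perm (Fin N)}
    (hπ : ∀ i j, y j < y i → π i < π j) :
    ∑ i, (2 * K)⁻¹ ^ (π i : ℕ) * ∑ j, B i j * (y j - y i) ≤
      -((2 * K)⁻¹ ^ N / (2 * (1 + K))) * ∑ i, ∑ j, B i j * |y i - y j| := by
  obtain ⟨g, hg, hyg⟩ := exists_layer_decomposition hy hπ
  set q := (2 * K)⁻¹ with hq
  have hq0 : 0 ≤ q := by positivity
  have hq1 : q ≤ 1 := inv_le_one_of_one_le₀ (by linarith)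
  set V : ℕ → Finset (Fin N) := fun l => Finset.univ.filter fun i => (π i : ℕ) ≤ l with hV
  have hmem : ∀ l i, i ∈ V l ↔ (π i : ℕ) ≤ l := fun l i => by simp [hV]
  simp only [← hmem] at hyg
  have hlay : ∀ l ∈ Finset.range N,
      ∑ i, q ^ (π i : ℕ) * ∑ j, B i j *
          ((if j ∈ V l then 1 else 0) - (if i ∈ V l then 1 else 0)) ≤
        -(q ^ N / (2 * (1 + K))) *
          ∑ i, ∑ j, B i j * |(if i ∈ V l then (1:ℝ) else 0) - (if j ∈ V l then 1 else 0)| := by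
    intro l hl
    have hc : ∑ j ∈ V l, ∑ k ∈ (V l)ᶜ, B k j ≤ K * ∑ j ∈ V l, ∑ k ∈ (V l)ᶜ, B j k := by
      rcases (V l).eq_empty_or_nonempty with h | h
      · simp [h]
      · by_cases hu : V l = Finset.univ
        · simp [hu]
        · exact hcut _ h hu
    refine (sum_weight_mul_indicator_le hB hK hc (a := q ^ l) (pow_nonneg hq0 l)
      (fun i hi => ?_) fun i hi => ?_).trans ?_
    · exact pow_le_pow_of_le_one hq0 hq1 ((hmem l i).1 hi)
    · rw [hmem, not_le] at hi
      rw [div_eq_mul_inv, ← hq, ← pow_succ]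
      exact pow_le_pow_of_le_one hq0 hq1 hi
    · refine mul_le_mul_of_nonneg_right (neg_le_neg ?_) (Finset.sum_nonneg fun i _ =>
        Finset.sum_nonneg fun j _ => mul_nonneg (hB i j) (abs_nonneg _))
      have : q ^ N ≤ q ^ l := pow_le_pow_of_le_one hq0 hq1 (Finset.mem_range.1 hl).le
      gcongr
  have hdiff : ∀ i j, y j - y i = ∑ l ∈ Finset.range N,
      g l * ((if j ∈ V l then 1 else 0) - (if i ∈ V l then 1 else 0)) := by
    intro i j
    rw [hyg i, hyg j, ← Finset.sum_sub_distrib]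
    exact Finset.sum_congr rfl fun l _ => by ring
  have hL : ∑ i, q ^ (π i : ℕ) * ∑ j, B i j * (y j - y i) = ∑ l ∈ Finset.range N, g l *
      ∑ i, q ^ (π i : ℕ) * ∑ j, B i j *
          ((if j ∈ V l then 1 else 0) - (if i ∈ V l then 1 else 0)) := by
    simp only [hdiff, Finset.mul_sum]
    rw [Finset.sum_comm]
    conv_rhs => rw [Finset.sum_comm' (t' := Finset.univ) (s' := fun _ => Finset.range N) (by simp)]
    rw [Finset.sum_comm]
    refine Finset.sum_congr rfl fun i _ => ?_
    rw [Finset.sum_comm]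
    refine Finset.sum_congr rfl fun l _ => Finset.sum_congr rfl fun j _ => by ring
  have hR : ∑ i, ∑ j, B i j * |y i - y j| ≤ ∑ l ∈ Finset.range N, g l *
      ∑ i, ∑ j, B i j * |(if i ∈ V l then (1:ℝ) else 0) - (if j ∈ V l then 1 else 0)| := by
    simp only [Finset.mul_sum]
    rw [Finset.sum_comm]
    conv_rhs => rw [Finset.sum_comm]
    rw [Finset.sum_comm]
    refine Finset.sum_le_sum fun i _ => ?_
    rw [Finset.sum_comm]
    refine Finset.sum_le_sum fun j _ => ?_
    rw [hdiff j i]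
    calc B i j * |∑ l ∈ Finset.range N, g l * _| ≤ B i j * ∑ l ∈ Finset.range N, |g l * _| :=
          mul_le_mul_of_nonneg_left (Finset.abs_sum_le_sum_abs _ _) (hB i j)
      _ = _ := by
          rw [Finset.mul_sum]
          refine Finset.sum_congr rfl fun l _ => ?_
          rw [abs_mul, abs_of_nonneg (hg l)]; ring
  rw [hL]
  calc _ ≤ ∑ l ∈ Finset.range N, g l * (-(q ^ N / (2 * (1 + K))) *
          ∑ i, ∑ j, B i j * |(if i ∈ V l then (1:ℝ) else 0) - (if j ∈ V l then 1 else 0)|) :=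
        Finset.sum_le_sum fun l hl => mul_le_mul_of_nonneg_left (hlay l hl) (hg l)
    _ = -(q ^ N / (2 * (1 + K))) * ∑ l ∈ Finset.range N, g l *
          ∑ i, ∑ j, B i j * |(if i ∈ V l then (1:ℝ) else 0) - (if j ∈ V l then 1 else 0)| := by
        rw [Finset.mul_sum]
        exact Finset.sum_congr rfl fun l _ => by ring
    _ ≤ _ := by
        have : 0 ≤ q ^ N / (2 * (1 + K)) := by positivity
        nlinarith

/-- A permutation maximising a sum with strictly decreasing positive weights sorts the vector. -/
theorem lt_of_isMax_perm {w : Fin N → ℝ} (hw : StrictAnti w) {y : Fin N → ℝ}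
    {π : Equiv.Perm (Fin N)}
    (hmax : ∀ σ : Equiv.Perm (Fin N), ∑ i, w (σ i) * y i ≤ ∑ i, w (π i) * y i)
    (i j : Fin N) (hij : y j < y i) : π i < π j := by
  by_contra! hle
  have hne : i ≠ j := by rintro rfl; exact lt_irrefl _ hij
  have hlt : π j < π i := lt_of_le_of_ne hle fun h => hne (π.injective h.symm)
  have h := hmax (Equiv.swap i j |>.trans π)
  have hsum : ∑ k, (w ((Equiv.swap i j |>.trans π) k) * y k - w (π k) * y k) =
      (w (π j) * y i - w (π i) * y i) + (w (π i) * y j - w (π j) * y j) := by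
    rw [Finset.sum_eq_add i j hne]
    · simp
    · intro k _ hk
      simp [Equiv.swap_apply_of_ne_of_ne hk.1 hk.2]
    · simp
    · simp
  rw [Finset.sum_sub_distrib] at hsum
  have := hw hlt
  nlinarith [mul_pos (sub_pos.2 this) (sub_pos.2 hij)]

end CutBalance

section HalfLine

theorem lintegral_eq_top_iff_not_integrableOn {f : ℝ → ℝ} (hf : Measurable f)
    (h0 : ∀ t, 0 ≤ f t) :
    ∫⁻ t in Set.Ici (0:ℝ), ENNReal.ofReal (f t) = ⊤ ↔ ¬ IntegrableOn f (Set.Ioi 0) := by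
  rw [← integrableOn_Ici_iff_integrableOn_Ioi, IntegrableOn,
    ← lintegral_ofReal_ne_top_iff_integrable hf.aestronglyMeasurable (ae_of_all _ h0), not_not]

theorem integrableOn_Ioi_of_integral_le {f : ℝ → ℝ} {I : ℝ}
    (hf : ∀ b, 0 ≤ b → IntervalIntegrable f volume 0 b) (h0 : ∀ᵐ t, 0 < t → 0 ≤ f t)
    (hI : ∀ b, 0 ≤ b → ∫ t in (0:ℝ)..b, f t ≤ I) : IntegrableOn f (Set.Ioi 0) := by
  refine integrableOn_Ioi_of_intervalIntegral_norm_bounded (l := atTop) (b := fun n : ℕ => (n:ℝ))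
    I 0 (fun n => (hf n n.cast_nonneg).1) tendsto_natCast_atTop_atTop
    (Eventually.of_forall fun n => ?_)
  refine le_trans (le_of_eq ?_) (hI n n.cast_nonneg)
  refine intervalIntegral.integral_congr_ae ?_
  filter_upwards [h0] with t ht hmem
  rw [Set.uIoc_of_le n.cast_nonneg] at hmem
  exact Real.norm_of_nonneg (ht hmem.1)

theorem integrableOn_Ioi_of_mul_le {f g : ℝ → ℝ} (hf : Measurable f) (h0 : ∀ t, 0 ≤ f t)
    (hb : ∀ T, ∃ C, ∀ t ∈ Set.Icc (0:ℝ) T, f t ≤ C) (hg : IntegrableOn g (Set.Ioi 0))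
    {δ T : ℝ} (hδ : 0 < δ) (hT : 0 ≤ T) (hle : ∀ᵐ t, T < t → δ * f t ≤ g t) :
    IntegrableOn f (Set.Ioi 0) := by
  rw [← Set.Ioc_union_Ioi_eq_Ioi hT]
  refine IntegrableOn.union ?_ ?_
  · obtain ⟨C, hC⟩ := hb T
    refine (integrableOn_Icc_of_bounded hf (C := C) fun t ht => ?_).mono_set Set.Ioc_subset_Icc_self
    rw [abs_of_nonneg (h0 t)]
    exact hC t ht
  · refine Integrable.mono' ((hg.mono_set (Set.Ioi_subset_Ioi hT)).const_mul δ⁻¹)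
      hf.aestronglyMeasurable ?_
    rw [ae_restrict_iff' measurableSet_Ioi]
    filter_upwards [hle] with t ht hmem
    rw [Real.norm_of_nonneg (h0 t), le_inv_mul_iff₀ hδ]
    exact ht hmem

theorem exists_forall_integral_le {f : ℝ → ℝ} (hf : IntegrableOn f (Set.Ioi 0))
    {ε : ℝ} (hε : 0 < ε) : ∃ T, 0 ≤ T ∧ ∀ t, T ≤ t → ∫ s in T..t, f s ≤ ε := by
  have h := intervalIntegral_tendsto_integral_Ioi 0 hf tendsto_id
  rw [Metric.tendsto_atTop] at h
  obtain ⟨T, hT⟩ := h (ε / 2) (by linarith)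
  have hint : ∀ t, 0 ≤ t → IntervalIntegrable f volume 0 t := fun t ht => by
    rw [intervalIntegrable_iff_integrableOn_Ioc_of_le ht]
    exact hf.mono_set Set.Ioc_subset_Ioi_self
  refine ⟨max T 0, le_max_right _ _, fun t ht => ?_⟩
  have h1 := hT (max T 0) (le_max_left _ _)
  have h2 := hT t ((le_max_left _ _).trans ht)
  simp only [id, Real.dist_eq, abs_lt] at h1 h2
  rw [← intervalIntegral.integral_interval_sub_left (hint t ((le_max_right _ _).trans ht))
    (hint _ (le_max_right _ _))]
  linarith [h1.1, h2.2]

end HalfLine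

section Moduli

variable {N : ℕ} {A : ℝ → Matrix (Fin N) (Fin N) ℝ} {x : ℝ → Fin N → ℝ}

namespace IsSolution

theorem lipschitzOnWith_abs (hA : IsAdjacency A) (hx : IsSolution A x) (b : ℝ) :
    ∃ K : NNReal, ∀ i, LipschitzOnWith K (fun t => |x t i|) (Set.Icc 0 b) := by
  obtain ⟨K, hK⟩ := hx.lipschitzOnWith hA b
  refine ⟨K, fun i => ?_⟩
  have := (lipschitzWith_one_norm (E := ℝ)).comp_lipschitzOnWith (hK i)
  rwa [one_mul] at this

theorem absolutelyContinuousOnInterval_abs (hA : IsAdjacency A) (hx : IsSolution A x) {b : ℝ}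
    (hb : 0 ≤ b) (i : Fin N) : AbsolutelyContinuousOnInterval (fun t => |x t i|) 0 b := by
  obtain ⟨K, hK⟩ := hx.lipschitzOnWith_abs hA b
  exact LipschitzOnWith.absolutelyContinuousOnInterval (by rw [Set.uIcc_of_le hb]; exact hK i)

theorem ae_differentiableAt_abs (hA : IsAdjacency A) (hx : IsSolution A x) :
    ∀ᵐ t, 0 < t → ∀ i, DifferentiableAt ℝ (fun t => |x t i|) t := by
  have h : ∀ (n : ℕ) (i : Fin N), ∀ᵐ t, t ∈ Set.uIcc (0:ℝ) n →
      DifferentiableAt ℝ (fun t => |x t i|) t := fun n i =>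
    (hx.absolutelyContinuousOnInterval_abs hA n.cast_nonneg i).ae_differentiableAt
  simp only [← ae_all_iff] at h
  filter_upwards [h] with t ht h0 i
  obtain ⟨n, hn⟩ := exists_nat_ge t
  exact ht n i (by rw [Set.uIcc_of_le n.cast_nonneg]; exact ⟨h0.le, hn⟩)

theorem ae_deriv_abs_eq (hA : IsAdjacency A) (hx : IsSolution A x) :
    ∀ᵐ t, 0 < t → ∀ i, ∀ s : ℝ, s = 1 ∨ s = -1 → 0 < s * x t i →
      deriv (fun t => |x t i|) t = s * ∑ k, (A t i k * x t k - |A t i k| * x t i) := by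
  filter_upwards [hx.ae_hasDerivAt hA] with t ht h0 i s hs hpos
  have h1 := (ht h0 i).const_mul s
  refine (h1.congr_of_eventuallyEq ?_).deriv
  filter_upwards [h1.continuousAt.eventually (lt_mem_nhds hpos)] with u hu
  rcases hs with rfl | rfl
  · rw [one_mul] at hu ⊢; exact abs_of_pos hu
  · rw [abs_of_neg (by linarith)]; ring

theorem ae_deriv_abs_le (hA : IsAdjacency A) (hx : IsSolution A x) :
    ∀ᵐ t, 0 < t → ∀ i,
      deriv (fun t => |x t i|) t ≤ ∑ k, |A t i k| * (|x t k| - |x t i|) := by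
  filter_upwards [hx.ae_deriv_abs_eq hA] with t ht h0 i
  have hterm : ∀ s : ℝ, s = 1 ∨ s = -1 → 0 < s * x t i →
      deriv (fun t => |x t i|) t ≤ ∑ k, |A t i k| * (|x t k| - |x t i|) := by
    intro s hs hpos
    rw [ht h0 i s hs hpos, Finset.mul_sum]
    refine Finset.sum_le_sum fun k _ => ?_
    have habs : |x t i| = s * x t i := by
      rcases hs with rfl | rfl
      · rw [one_mul] at hpos ⊢; exact abs_of_pos hpos
      · rw [abs_of_neg (by linarith)]; ring
    have hle : s * (A t i k * x t k) ≤ |A t i k| * |x t k| := by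
      rw [← abs_mul]
      rcases hs with rfl | rfl
      · rw [one_mul]; exact le_abs_self _
      · rw [neg_one_mul]; exact neg_le_abs _
    rw [habs]; linarith
  rcases lt_trichotomy (x t i) 0 with h | h | h
  · exact hterm (-1) (Or.inr rfl) (by linarith)
  · have hmin : IsLocalMin (fun t => |x t i|) t :=
      Eventually.of_forall fun u => by simp only [h, abs_zero]; exact abs_nonneg _
    rw [hmin.deriv_eq_zero, h, abs_zero]
    exact Finset.sum_nonneg fun k _ => by rw [sub_zero]; positivity
  · exact hterm 1 (Or.inl rfl) (by linarith)

/-- The maximal modulus over a group `W` of agents grows at most by the influence of the other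
agents. -/
theorem abs_le_add_integral (hA : IsAdjacency A) (hx : IsSolution A x) {W : Finset (Fin N)}
    {T t m₀ m : ℝ} (hT : 0 ≤ T) (hTt : T ≤ t)
    (hm : ∀ s ∈ Set.Icc T t, ∀ k, k ∉ W → |x s k| ≤ m) (hm₀ : ∀ i ∈ W, |x T i| ≤ m₀)
    {i : Fin N} (hi : i ∈ W) :
    |x t i| ≤ m₀ + ∫ s in T..t, ∑ j ∈ W, ∑ k ∈ Wᶜ, |A s j k| * m := by
  obtain ⟨K, hK⟩ := hx.lipschitzOnWith_abs hA t
  obtain ⟨C, hC⟩ := hA.2.1 t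
  have hint : IntervalIntegrable (fun s => ∑ j ∈ W, ∑ k ∈ Wᶜ, |A s j k| * m) volume T t := by
    rw [intervalIntegrable_iff_integrableOn_Ioc_of_le hTt]
    refine IntegrableOn.mono_set ?_ (show Set.Ioc T t ⊆ Set.Icc 0 t from
      fun s hs => ⟨hT.trans hs.1.le, hs.2⟩)
    refine integrable_finsetSum _ fun j _ => integrable_finsetSum _ fun k _ => ?_
    exact (integrableOn_Icc_of_bounded (hA.1 j k) fun s hs => hC s hs j k).abs.mul_const m
  refine le_add_integral_of_deriv_le_of_isMax (s := W) ⟨i, hi⟩ (f := fun i t => |x t i|)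
    hTt (K := K) (fun j _ => (hK j).mono (Set.Icc_subset_Icc_left hT)) hint ?_ hm₀ hi
  filter_upwards [hx.ae_deriv_abs_le hA] with s hs hsT j hj hmax
  refine (hs (hT.trans_lt hsT.1) j).trans ?_
  have h1 : ∑ k, |A s j k| * (|x s k| - |x s j|) ≤ ∑ k ∈ Wᶜ, |A s j k| * m := by
    rw [← Finset.sum_add_sum_compl W]
    have h2 : ∑ k ∈ W, |A s j k| * (|x s k| - |x s j|) ≤ 0 :=
      Finset.sum_nonpos fun k hk =>
        mul_nonpos_of_nonneg_of_nonpos (abs_nonneg _) (sub_nonpos.2 (hmax k hk))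
    have h3 : ∑ k ∈ Wᶜ, |A s j k| * (|x s k| - |x s j|) ≤ ∑ k ∈ Wᶜ, |A s j k| * m :=
      Finset.sum_le_sum fun k hk => mul_le_mul_of_nonneg_left
        (by linarith [abs_nonneg (x s j),
          hm s (Set.Ioo_subset_Icc_self hsT) k (Finset.mem_compl.1 hk)]) (abs_nonneg _)
    linarith
  refine h1.trans (Finset.single_le_sum (f := fun j => ∑ k ∈ Wᶜ, |A s j k| * m) (fun j' _ => ?_) hj)
  refine Finset.sum_nonneg fun k hk => mul_nonneg (abs_nonneg _) ?_
  exact (abs_nonneg _).trans (hm s (Set.Ioo_subset_Icc_self hsT) k (Finset.mem_compl.1 hk))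

theorem abs_le_of_abs_le (hA : IsAdjacency A) (hx : IsSolution A x) {T t m : ℝ} (hT : 0 ≤ T)
    (hTt : T ≤ t) (hm : ∀ i, |x T i| ≤ m) (i : Fin N) : |x t i| ≤ m := by
  simpa using hx.abs_le_add_integral hA (W := Finset.univ) (m := m) hT hTt (by simp)
    (fun i _ => hm i) (Finset.mem_univ i)

theorem eq_zero_of_initial_eq_zero (hA : IsAdjacency A) (hx : IsSolution A x) (h0 : x 0 = 0)
    {t : ℝ} (ht : 0 ≤ t) (i : Fin N) : x t i = 0 :=
  abs_nonpos_iff.1 (hx.abs_le_of_abs_le hA le_rfl ht (fun i => by simp [h0]) i)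

theorem integrableOn_Icc_abs_mul (hA : IsAdjacency A) (hx : IsSolution A x) (b : ℝ)
    {φ : (Fin N → ℝ) → ℝ} (hφ : Continuous φ) (i k : Fin N) :
    IntegrableOn (fun t => |A t i k| * φ (x t)) (Set.Icc 0 b) := by
  obtain ⟨C, hC⟩ := hA.2.1 b
  have h : IntegrableOn (fun t => |A t i k|) (Set.Icc 0 b) :=
    (integrableOn_Icc_of_bounded (hA.1 i k) fun t ht => hC t ht i k).abs
  exact h.mul_continuousOn
    (hφ.comp_continuousOn (hx.1.mono Set.Icc_subset_Ici_self)) isCompact_Icc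

theorem aemeasurable_apply (hx : IsSolution A x) (i : Fin N) :
    AEMeasurable (fun t => x t i) (volume.restrict (Set.Ioi 0)) :=
  ((hx.continuousOn_apply i).mono Set.Ioi_subset_Ici_self).aemeasurable measurableSet_Ioi

/-- Under cut-balance the total interaction between disagreeing moduli is finite, and so is the
total loss of modulus due to conflicting signs. -/
theorem integrableOn_interaction (hA : IsAdjacency A) (hCB : CutBalanced A)
    (hx : IsSolution A x) :
    (∀ i k, IntegrableOn (fun t => |A t i k| * |(|x t i| - |x t k|)|) (Set.Ioi 0)) ∧
    (∀ i, IntegrableOn (fun t => ∑ k, |A t i k| * (|x t k| - |x t i|) -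
      deriv (fun t => |x t i|) t) (Set.Ioi 0)) := by
  obtain ⟨K, hK, hcut⟩ := hCB
  set q : ℝ := (2 * K)⁻¹ with hq
  have hq0 : 0 < q := by positivity
  have hq1 : q < 1 := inv_lt_one_of_one_lt₀ (by linarith)
  set c : ℝ := q ^ N / (2 * (1 + K)) with hc
  have hc0 : 0 < c := by positivity
  set D : ℝ → ℝ := fun t => ∑ i, ∑ k, |A t i k| * |(|x t i| - |x t k|)| with hD
  set loss : Fin N → ℝ → ℝ := fun i t => ∑ k, |A t i k| * (|x t k| - |x t i|) -
      deriv (fun t => |x t i|) t with hloss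
  set w : Fin N → ℝ := fun r => q ^ (r : ℕ) with hw
  have hw_anti : StrictAnti w := fun r s hrs => pow_lt_pow_right_of_lt_one₀ hq0 hq1 hrs
  have hw_ge : ∀ r, q ^ N ≤ w r := fun r => pow_le_pow_of_le_one hq0.le hq1.le r.2.le
  have hDint : ∀ b, 0 ≤ b → IntervalIntegrable D volume 0 b := fun b hb => by
    rw [intervalIntegrable_iff_integrableOn_Icc_of_le hb]
    refine integrable_finsetSum _ fun i _ => integrable_finsetSum _ fun k _ => ?_
    exact hx.integrableOn_Icc_abs_mul hA b (φ := fun z => |(|z i| - |z k|)|) (by fun_prop) i k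
  have hlint : ∀ i b, 0 ≤ b → IntervalIntegrable (loss i) volume 0 b := fun i b hb => by
    refine IntervalIntegrable.sub ?_
      (hx.absolutelyContinuousOnInterval_abs hA hb i).intervalIntegrable_deriv
    rw [intervalIntegrable_iff_integrableOn_Icc_of_le hb]
    refine integrable_finsetSum _ fun k _ => ?_
    exact hx.integrableOn_Icc_abs_mul hA b (φ := fun z => |z k| - |z i|) (by fun_prop) i k
  have hl0 : ∀ᵐ t, 0 < t → ∀ i, 0 ≤ loss i t := by
    filter_upwards [hx.ae_deriv_abs_le hA] with t ht h0 i using sub_nonneg.2 (ht h0 i)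
  have hD0 : ∀ t, 0 ≤ D t := fun t => by positivity
  set G : ℝ → ℝ := fun t => c * D t + q ^ N * ∑ i, loss i t with hG
  have hGint : ∀ b, 0 ≤ b → IntervalIntegrable G volume 0 b := fun b hb => by
    refine ((hDint b hb).const_mul c).add (IntervalIntegrable.const_mul ?_ _)
    rw [show (fun t => ∑ i, loss i t) = ∑ i, loss i from (Finset.sum_fn _ _).symm]
    exact IntervalIntegrable.sum Finset.univ fun i _ => hlint i b hb
  have hG0 : ∀ᵐ t, 0 < t → 0 ≤ G t := by
    filter_upwards [hl0] with t ht h0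
    have := hD0 t
    have := Finset.sum_nonneg fun i (_ : i ∈ Finset.univ) => ht h0 i
    positivity
  have hwsum : ∀ (π : Equiv.Perm (Fin N)) t, 0 ≤ ∑ i, w (π i) * |x t i| := fun π t =>
    Finset.sum_nonneg fun i _ => mul_nonneg (by positivity) (abs_nonneg _)
  set I : ℝ := ∑ π : Equiv.Perm (Fin N), ∑ i, w (π i) * |x 0 i| with hI
  have hcut' : ∀ᵐ t, 0 < t → ∀ V : Finset (Fin N), V.Nonempty → V ≠ Finset.univ →
      ∑ j ∈ V, ∑ k ∈ Vᶜ, |A t k j| ≤ K * ∑ j ∈ V, ∑ k ∈ Vᶜ, |A t j k| := by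
    rw [ae_restrict_iff' measurableSet_Ici] at hcut
    filter_upwards [hcut] with t ht h0 V hV hV'
    have := (ht (Set.mem_Ici.2 h0.le) V hV hV').1
    rwa [inv_mul_le_iff₀ (by linarith)] at this
  have hGI : ∀ b, 0 ≤ b → ∫ t in (0:ℝ)..b, G t ≤ I := by
    intro b hb
    obtain ⟨L, hL⟩ := hx.lipschitzOnWith_abs hA b
    have hlip : ∀ π : Equiv.Perm (Fin N), π ∈ Finset.univ →
        LipschitzOnWith (Real.toNNReal (∑ _i : Fin N, (L : ℝ)))
          (fun t => ∑ i, w (π i) * |x t i|) (Set.Icc 0 b) := by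
      intro π _
      refine LipschitzOnWith.of_le_add_mul' _ fun s hs t ht => ?_
      rw [Finset.sum_mul, ← Finset.sum_add_distrib]
      refine Finset.sum_le_sum fun i _ => ?_
      have h1 := (hL i).le_add_mul hs ht
      have h2 : 0 ≤ w (π i) := by positivity
      have h3 : w (π i) ≤ 1 := pow_le_one₀ hq0.le hq1.le
      have h4 : 0 ≤ (L : ℝ) * dist s t := by positivity
      nlinarith
    have hd : ∀ᵐ t, t ∈ Set.Ioo 0 b → ∀ π ∈ (Finset.univ : Finset (Equiv.Perm (Fin N))),
        (∀ σ ∈ (Finset.univ : Finset (Equiv.Perm (Fin N))),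
          ∑ i, w (σ i) * |x t i| ≤ ∑ i, w (π i) * |x t i|) →
        deriv (fun t => ∑ i, w (π i) * |x t i|) t ≤ -G t := by
      filter_upwards [hx.ae_differentiableAt_abs hA, hl0, hcut'] with t h1 h2 h3 ht π _ hmax
      have hsort := lt_of_isMax_perm hw_anti (y := fun i => |x t i|) (π := π)
        fun σ => hmax σ (Finset.mem_univ _)
      have hmain := sum_weight_mul_diff_le (B := fun i k => |A t i k|) (fun _ _ => abs_nonneg _)
        hK (h3 ht.1) (fun i => abs_nonneg (x t i)) hsort
      have hder : deriv (fun t => ∑ i, w (π i) * |x t i|) t =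
          ∑ i, w (π i) * deriv (fun t => |x t i|) t :=
        (HasDerivAt.fun_sum fun i _ => ((h1 ht.1 i).hasDerivAt).const_mul (w (π i))).deriv
      have hsplit : ∀ i, w (π i) * deriv (fun t => |x t i|) t =
          w (π i) * (∑ k, |A t i k| * (|x t k| - |x t i|)) - w (π i) * loss i t := fun i => by
        simp only [hloss]; ring
      rw [hder, Finset.sum_congr rfl fun i _ => hsplit i, Finset.sum_sub_distrib]
      have h5 : q ^ N * ∑ i, loss i t ≤ ∑ i, w (π i) * loss i t := by
        rw [Finset.mul_sum]
        exact Finset.sum_le_sum fun i _ => mul_le_mul_of_nonneg_right (hw_ge _) (h2 ht.1 i)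
      have h6 : ∑ i, w (π i) * (∑ k, |A t i k| * (|x t k| - |x t i|)) ≤ -c * D t := hmain
      simp only [hG]
      linarith
    have hfin := le_add_integral_of_deriv_le_of_isMax (s := Finset.univ)
      (f := fun (π : Equiv.Perm (Fin N)) t => ∑ i, w (π i) * |x t i|) ⟨1, Finset.mem_univ _⟩
      hb hlip (hGint b hb).neg hd (m := I)
      (fun π hπ => Finset.single_le_sum (f := fun π : Equiv.Perm (Fin N) => ∑ i, w (π i) * |x 0 i|)
        (fun σ _ => hwsum σ 0) hπ) (Finset.mem_univ 1)
    rw [show (∫ t in (0:ℝ)..b, (-G) t) = -∫ t in (0:ℝ)..b, G t from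
      intervalIntegral.integral_neg] at hfin
    linarith [hwsum 1 b]
  have hGi := integrableOn_Ioi_of_integral_le hGint hG0 hGI
  have hxm := fun i => hx.aemeasurable_apply i
  have hAm : ∀ i k, AEMeasurable (fun t => A t i k) (volume.restrict (Set.Ioi 0)) :=
    fun i k => (hA.1 i k).aemeasurable
  refine ⟨fun i k => Integrable.mono' (hGi.const_mul c⁻¹) ?_ ?_, fun i =>
    Integrable.mono' (hGi.const_mul (q ^ N)⁻¹) ?_ ?_⟩
  · exact ((hAm i k).abs.mul ((hxm i).abs.sub (hxm k).abs).abs).aestronglyMeasurable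
  · rw [ae_restrict_iff' measurableSet_Ioi]
    filter_upwards [hl0] with t ht h0
    rw [Real.norm_of_nonneg (by positivity), le_inv_mul_iff₀ hc0]
    have h1 : |A t i k| * |(|x t i| - |x t k|)| ≤ D t :=
      (Finset.single_le_sum (f := fun k => |A t i k| * |(|x t i| - |x t k|)|)
        (fun _ _ => by positivity) (Finset.mem_univ k)).trans
      (Finset.single_le_sum (f := fun i => ∑ k, |A t i k| * |(|x t i| - |x t k|)|)
        (fun _ _ => by positivity) (Finset.mem_univ i))
    have h2 : 0 ≤ q ^ N * ∑ i, loss i t :=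
      mul_nonneg (by positivity) (Finset.sum_nonneg fun i _ => ht h0 i)
    have h3 := mul_le_mul_of_nonneg_left h1 hc0.le
    simp only [hG]; linarith
  · refine AEMeasurable.aestronglyMeasurable (AEMeasurable.sub ?_ (measurable_deriv _).aemeasurable)
    exact Finset.aemeasurable_fun_sum _ fun k _ => (hAm i k).abs.mul ((hxm k).abs.sub (hxm i).abs)
  · rw [ae_restrict_iff' measurableSet_Ioi]
    filter_upwards [hl0] with t ht h0
    rw [Real.norm_of_nonneg (ht h0 i), le_inv_mul_iff₀ (by positivity)]
    have h1 : loss i t ≤ ∑ i, loss i t :=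
      Finset.single_le_sum (fun i _ => ht h0 i) (Finset.mem_univ i)
    have h2 := mul_le_mul_of_nonneg_left h1 (pow_pos hq0 N).le
    have h3 := mul_nonneg hc0.le (hD0 t)
    simp only [hG]; linarith

theorem exists_tendsto_abs (hA : IsAdjacency A) (hCB : CutBalanced A) (hx : IsSolution A x)
    (i : Fin N) : ∃ c, Tendsto (fun t => |x t i|) atTop (𝓝 c) := by
  obtain ⟨h1, h2⟩ := hx.integrableOn_interaction hA hCB
  have h3 : IntegrableOn (fun t => ∑ k, |A t i k| * (|x t k| - |x t i|)) (Set.Ioi 0) := by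
    refine integrable_finsetSum _ fun k _ => (integrable_norm_iff ?_).1 ?_
    · exact (((hA.1 i k).aemeasurable.abs).mul
        ((hx.aemeasurable_apply k).abs.sub (hx.aemeasurable_apply i).abs)).aestronglyMeasurable
    · refine (h1 i k).congr (ae_of_all _ fun t => ?_)
      simp only [Real.norm_eq_abs, abs_mul, abs_abs]
      rw [abs_sub_comm]
  have h4 : IntegrableOn (deriv fun t => |x t i|) (Set.Ioi 0) := by
    refine (Integrable.sub h3 (h2 i)).congr (ae_of_all _ fun t => ?_)
    simp
  refine ⟨|x 0 i| + ∫ t in Set.Ioi 0, deriv (fun t => |x t i|) t, ?_⟩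
  refine ((intervalIntegral_tendsto_integral_Ioi 0 h4 tendsto_id).const_add |x 0 i|).congr' ?_
  filter_upwards [eventually_ge_atTop 0] with t ht
  simp only [id]
  rw [(hx.absolutelyContinuousOnInterval_abs hA ht i).integral_deriv_eq_sub]
  ring

end IsSolution

end Moduli

section EssentialArcs

variable {N : ℕ} {A : ℝ → Matrix (Fin N) (Fin N) ℝ} {x : ℝ → Fin N → ℝ}

theorem essArc_iff (hA : IsAdjacency A) (i j : Fin N) :
    EssArc A i j ↔ ¬ IntegrableOn (fun t => |A t i j|) (Set.Ioi 0) :=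
  lintegral_eq_top_iff_not_integrableOn (measurable_abs.comp (hA.1 i j)) fun _ => abs_nonneg _

theorem essPlus_iff (hA : IsAdjacency A) (i j : Fin N) :
    EssPlus A i j ↔ ¬ IntegrableOn (fun t => max (A t i j) 0) (Set.Ioi 0) :=
  lintegral_eq_top_iff_not_integrableOn ((hA.1 i j).max measurable_const)
    fun _ => le_max_right _ _

theorem essMinus_iff (hA : IsAdjacency A) (i j : Fin N) :
    EssMinus A i j ↔ ¬ IntegrableOn (fun t => max (-(A t i j)) 0) (Set.Ioi 0) :=
  lintegral_eq_top_iff_not_integrableOn ((hA.1 i j).neg.max measurable_const)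
    fun _ => le_max_right _ _

theorem EssArc.essPlus_or_essMinus (hA : IsAdjacency A) {i j : Fin N} (h : EssArc A i j) :
    EssPlus A i j ∨ EssMinus A i j := by
  rw [essArc_iff hA] at h
  rw [essPlus_iff hA, essMinus_iff hA]
  by_contra! hc
  refine h ((hc.1.add hc.2).congr (ae_of_all _ fun t => ?_))
  rcases le_total 0 (A t i j) with h0 | h0
  · simp [abs_of_nonneg h0, h0]
  · simp [abs_of_nonpos h0, h0]

/-- Propagation of a relation along paths of essential arcs. -/
theorem EssReach.rel {r : Fin N → Fin N → Prop} (hrefl : ∀ i, r i i)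
    (htrans : ∀ i j k, r i j → r j k → r i k) (h : ∀ i j, EssArc A j i → r i j) {u v : Fin N}
    (huv : EssReach A u v) : r u v := by
  induction huv with
  | refl => exact hrefl u
  | tail _ hab ih => exact htrans _ _ _ ih (h _ _ hab)

namespace IsSolution

theorem eq_of_essArc (hA : IsAdjacency A) (hCB : CutBalanced A) (hx : IsSolution A x)
    {c : Fin N → ℝ} (hc : ∀ i, Tendsto (fun t => |x t i|) atTop (𝓝 (c i))) {i j : Fin N}
    (h : EssArc A i j) : c j = c i := by
  by_contra hne
  rw [essArc_iff hA] at h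
  have hlim : Tendsto (fun t => |(|x t i| - |x t j|)|) atTop (𝓝 |c i - c j|) :=
    ((hc i).sub (hc j)).abs
  have hpos : 0 < |c i - c j| := abs_pos.2 (sub_ne_zero.2 (Ne.symm hne))
  obtain ⟨T, hT⟩ := eventually_atTop.1 (hlim.eventually (lt_mem_nhds (half_lt_self hpos)))
  refine h (integrableOn_Ioi_of_mul_le (measurable_abs.comp (hA.1 i j)) (fun _ => abs_nonneg _)
    (fun T => ?_) ((hx.integrableOn_interaction hA hCB).1 i j) (half_pos hpos)
    (le_max_right T 0) (ae_of_all _ fun t ht => ?_))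
  · obtain ⟨C, hC⟩ := hA.2.1 T
    exact ⟨C, fun t ht => hC t ht i j⟩
  · rw [mul_comm]
    exact mul_le_mul_of_nonneg_left (hT t ((le_max_left _ _).trans ht.le)).le (abs_nonneg _)

/-- On a strongly connected graph of essential interactions all moduli have a common limit. -/
theorem exists_tendsto_abs_common (hA : IsAdjacency A) (hCB : CutBalanced A)
    (hx : IsSolution A x) (hN : 0 < N) (hS : ∀ u v, EssReach A u v) :
    ∃ c, 0 ≤ c ∧ ∀ i, Tendsto (fun t => |x t i|) atTop (𝓝 c) := by
  choose c hc using hx.exists_tendsto_abs hA hCB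
  refine ⟨c ⟨0, hN⟩, ge_of_tendsto' (hc _) fun t => abs_nonneg _, fun i => ?_⟩
  rw [EssReach.rel (r := fun i j => c i = c j) (fun _ => rfl) (fun _ _ _ => Eq.trans)
    (fun i j h => hx.eq_of_essArc hA hCB hc h) (hS ⟨0, hN⟩ i)]
  exact hc i

/-- If all moduli converge to the same positive limit, the signs of the opinions freeze, and
interactions that contradict the limit signs are integrable. -/
theorem exists_limit_sign (hA : IsAdjacency A) (hCB : CutBalanced A) (hx : IsSolution A x)
    {c : ℝ} (hc : 0 < c) (hlim : ∀ i, Tendsto (fun t => |x t i|) atTop (𝓝 c)) :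
    ∃ σ : Fin N → ℝ, (∀ i, σ i = 1 ∨ σ i = -1) ∧
      (∀ i, Tendsto (fun t => x t i) atTop (𝓝 (σ i * c))) ∧
      ∀ i j, IntegrableOn (fun t => max (-(σ i * σ j * A t i j)) 0) (Set.Ioi 0) := by
  obtain ⟨T₀, hT₀⟩ := eventually_atTop.1
    (eventually_all.2 fun i => (hlim i).eventually (lt_mem_nhds (half_lt_self hc)))
  set T := max T₀ 0
  have hT0 : 0 ≤ T := le_max_right _ _
  have hT : ∀ t, T ≤ t → ∀ i, c / 2 < |x t i| := fun t ht => hT₀ t ((le_max_left _ _).trans ht)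
  set σ : Fin N → ℝ := fun i => if 0 < x T i then 1 else -1 with hσ
  have hσ1 : ∀ i, σ i = 1 ∨ σ i = -1 := fun i => by
    simp only [hσ]; split_ifs <;> simp
  have hσT : ∀ i, 0 < σ i * x T i := fun i => by
    have := hT T le_rfl i
    simp only [hσ]
    split_ifs with h
    · simpa using h
    · have h0 : x T i ≠ 0 := by
        rintro h0; rw [h0, abs_zero] at this; linarith
      have := lt_of_le_of_ne (not_lt.1 h) h0
      linarith
  have hpos : ∀ t, T ≤ t → ∀ i, 0 < σ i * x t i := by
    intro t ht i
    by_contra! hneg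
    have hcont : ContinuousOn (fun s => σ i * x s i) (Set.Icc T t) :=
      continuousOn_const.mul ((hx.continuousOn_apply i).mono fun s hs => hT0.trans hs.1)
    obtain ⟨s, hs, hs0⟩ := intermediate_value_Icc' ht hcont ⟨hneg, (hσT i).le⟩
    have h1 := hT s hs.1 i
    have h2 : x s i = 0 := by
      rcases hσ1 i with h | h <;> simpa [h] using hs0
    rw [h2, abs_zero] at h1
    linarith
  have habs : ∀ t, T ≤ t → ∀ i, x t i = σ i * |x t i| := by
    intro t ht i
    have := hpos t ht i
    rcases hσ1 i with h | h
    · rw [h, one_mul] at this; rw [h, abs_of_pos this, one_mul]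
    · rw [h] at this
      rw [h, abs_of_neg (by linarith)]; ring
  refine ⟨σ, hσ1, fun i => ?_, fun i j => ?_⟩
  · refine ((hlim i).const_mul (σ i)).congr' ?_
    filter_upwards [eventually_ge_atTop T] with t ht using (habs t ht i).symm
  refine integrableOn_Ioi_of_mul_le (((hA.1 i j).const_mul _).neg.max measurable_const)
    (fun _ => le_max_right _ _) (fun b => ?_) ((hx.integrableOn_interaction hA hCB).2 i) hc hT0 ?_
  · obtain ⟨C, hC⟩ := hA.2.1 b
    refine ⟨C, fun t ht => max_le ?_ ((abs_nonneg _).trans (hC t ht i j))⟩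
    have := hC t ht i j
    rw [abs_le] at this
    rcases hσ1 i with h | h <;> rcases hσ1 j with h' | h' <;> rw [h, h'] <;> linarith
  · filter_upwards [hx.ae_deriv_abs_eq hA] with t ht htT
    rw [ht (hT0.trans_lt htT) i (σ i) (hσ1 i) (hpos t htT.le i), Finset.mul_sum,
      ← Finset.sum_sub_distrib]
    have hterm : ∀ k, |A t i k| * (|x t k| - |x t i|) -
        σ i * (A t i k * x t k - |A t i k| * x t i) =
        2 * max (-(σ i * σ k * A t i k)) 0 * |x t k| := by
      intro k
      have h1 := habs t htT.le k
      have h2 := habs t htT.le i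
      set p := |x t k|
      set q := |x t i|
      rw [h1, h2]
      rcases le_total 0 (A t i k) with h0 | h0 <;>
      rcases hσ1 i with h | h <;> rcases hσ1 k with h' | h' <;> rw [h, h'] <;>
      first
        | rw [abs_of_nonneg h0]
        | rw [abs_of_nonpos h0]
      all_goals
        first
          | rw [max_eq_right (by linarith)]; ring
          | rw [max_eq_left (by linarith)]; ring
    simp only [hterm]
    refine le_trans ?_ (Finset.single_le_sum (f := fun k =>
      2 * max (-(σ i * σ k * A t i k)) 0 * |x t k|) (fun k _ => by positivity) (Finset.mem_univ j))
    have h1 := hT t htT.le j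
    have h2 : 0 ≤ max (-(σ i * σ j * A t i j)) 0 := le_max_right _ _
    nlinarith

end IsSolution

theorem not_essMinus_of_sign (hA : IsAdjacency A) {σ : Fin N → ℝ} {i j : Fin N}
    (hint : IntegrableOn (fun t => max (-(σ i * σ j * A t i j)) 0) (Set.Ioi 0))
    (h : σ i * σ j = 1) : ¬ EssMinus A i j := by
  rw [essMinus_iff hA, not_not]
  simpa [h] using hint

theorem not_essPlus_of_sign (hA : IsAdjacency A) {σ : Fin N → ℝ} {i j : Fin N}
    (hint : IntegrableOn (fun t => max (-(σ i * σ j * A t i j)) 0) (Set.Ioi 0))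
    (h : σ i * σ j = -1) : ¬ EssPlus A i j := by
  rw [essPlus_iff hA, not_not]
  simpa [h] using hint

theorem integrableOn_of_essStructBal (hA : IsAdjacency A) {S : Set (Fin N)} {ρ : Fin N → ℝ}
    (hρ : ∀ i, ρ i = 1 ∧ i ∈ S ∨ ρ i = -1 ∧ i ∉ S)
    (hP : ∀ j k, EssPlus A j k → (j ∈ S ↔ k ∈ S))
    (hM : ∀ j k, EssMinus A j k → ¬(j ∈ S ↔ k ∈ S)) (i j : Fin N) :
    IntegrableOn (fun t => max (-(ρ i * ρ j * A t i j)) 0) (Set.Ioi 0) := by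
  have hP' := hP i j
  have hM' := hM i j
  rw [essPlus_iff hA] at hP'
  rw [essMinus_iff hA] at hM'
  rcases hρ i with ⟨h, hi⟩ | ⟨h, hi⟩ <;> rcases hρ j with ⟨h', hj⟩ | ⟨h', hj⟩ <;>
    simp_all

theorem sign_mul_eq {ρ : Fin N → ℝ} (hρ : ∀ i, ρ i = 1 ∨ ρ i = -1) (i j : Fin N) :
    ρ i * ρ j = 1 ∧ ρ i = ρ j ∨ ρ i * ρ j = -1 ∧ ρ i = -ρ j := by
  rcases hρ i with h | h <;> rcases hρ j with h' | h' <;> simp [h, h']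

theorem essStructBal_of_sign (hA : IsAdjacency A) {σ : Fin N → ℝ}
    (hσ : ∀ i, σ i = 1 ∨ σ i = -1)
    (hint : ∀ i j, IntegrableOn (fun t => max (-(σ i * σ j * A t i j)) 0) (Set.Ioi 0)) :
    EssStructBal A := by
  refine ⟨{i | σ i = 1}, fun j k hjk => ?_, fun j k hjk hiff => ?_⟩
  · rcases sign_mul_eq hσ j k with ⟨_, h⟩ | ⟨h, _⟩
    · simp [h]
    · exact absurd hjk (not_essPlus_of_sign hA (hint j k) h)
  · refine not_essMinus_of_sign hA (hint j k) ?_ hjk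
    rcases sign_mul_eq hσ j k with ⟨h, _⟩ | ⟨_, h⟩
    · exact h
    · have hiff' : σ j = 1 ↔ σ k = 1 := hiff
      rw [h] at hiff'
      rcases hσ k with h' | h' <;> norm_num [h'] at hiff'

theorem sign_mul_eq_of_essArc (hA : IsAdjacency A) {σ ρ : Fin N → ℝ}
    (hσ : ∀ i, σ i = 1 ∨ σ i = -1) (hρ : ∀ i, ρ i = 1 ∨ ρ i = -1)
    (hint : ∀ i j, IntegrableOn (fun t => max (-(σ i * σ j * A t i j)) 0) (Set.Ioi 0))
    (hint' : ∀ i j, IntegrableOn (fun t => max (-(ρ i * ρ j * A t i j)) 0) (Set.Ioi 0))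
    {i j : Fin N} (h : EssArc A j i) : σ i * ρ i = σ j * ρ j := by
  rcases sign_mul_eq hσ j i with ⟨h1, h1'⟩ | ⟨h1, h1'⟩ <;>
    rcases sign_mul_eq hρ j i with ⟨h2, h2'⟩ | ⟨h2, h2'⟩
  · rw [h1', h2']
  · rcases h.essPlus_or_essMinus hA with h3 | h3
    · exact absurd h3 (not_essPlus_of_sign hA (hint' j i) h2)
    · exact absurd h3 (not_essMinus_of_sign hA (hint j i) h1)
  · rcases h.essPlus_or_essMinus hA with h3 | h3
    · exact absurd h3 (not_essPlus_of_sign hA (hint j i) h1)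
    · exact absurd h3 (not_essMinus_of_sign hA (hint' j i) h2)
  · rw [h1', h2']; ring

theorem IsSolution.tendsto_zero_of_not_essStructBal (hA : IsAdjacency A) (hCB : CutBalanced A)
    (hx : IsSolution A x) (hN : 0 < N) (hS : ∀ u v, EssReach A u v)
    (hunb : (∃ i j, EssPlus A i j ∧ EssMinus A i j) ∨ ¬ EssStructBal A) (i : Fin N) :
    Tendsto (fun t => x t i) atTop (𝓝 0) := by
  obtain ⟨c, hc0, hc⟩ := hx.exists_tendsto_abs_common hA hCB hN hS
  rcases hc0.eq_or_lt with rfl | hc0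
  · exact (tendsto_zero_iff_abs_tendsto_zero _).2 (hc i)
  obtain ⟨σ, hσ, -, hint⟩ := hx.exists_limit_sign hA hCB hc0 hc
  rcases hunb with ⟨j, k, hp, hm⟩ | h
  · rcases sign_mul_eq hσ j k with ⟨h, _⟩ | ⟨h, _⟩
    · exact absurd hm (not_essMinus_of_sign hA (hint j k) h)
    · exact absurd hp (not_essPlus_of_sign hA (hint j k) h)
  · exact absurd (essStructBal_of_sign hA hσ hint) h

end EssentialArcs

section BipartiteConsensus

variable {N : ℕ} {A : ℝ → Matrix (Fin N) (Fin N) ℝ} {x : ℝ → Fin N → ℝ}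

namespace IsSolution

theorem eq_sum_of_basis (hA : IsAdjacency A) (hx : IsSolution A x) {z : Fin N → ℝ → Fin N → ℝ}
    (hz : ∀ j, IsSolution A (z j)) (hz0 : ∀ j, z j 0 = Pi.single j 1) {t : ℝ} (ht : 0 ≤ t)
    (i : Fin N) : x t i = ∑ j, z j t i * x 0 j := by
  have hy : IsSolution A (x - ∑ j, x 0 j • z j) :=
    hx.sub hA (IsSolution.sum hA _ fun j _ => (hz j).const_smul _)
  have h0 : (x - ∑ j, x 0 j • z j) 0 = 0 := by
    ext k
    simp [Finset.sum_apply, hz0, Pi.single_apply]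
  have := hy.eq_zero_of_initial_eq_zero hA h0 ht i
  simp only [Pi.sub_apply, Finset.sum_apply, Pi.smul_apply, smul_eq_mul, sub_eq_zero] at this
  rw [this]
  exact Finset.sum_congr rfl fun j _ => mul_comm _ _

theorem exists_tendsto_sign_mul (hA : IsAdjacency A) (hCB : CutBalanced A)
    (hx : IsSolution A x) (hN : 0 < N) (hS : ∀ u v, EssReach A u v) {ρ : Fin N → ℝ}
    (hρ : ∀ i, ρ i = 1 ∨ ρ i = -1)
    (hint : ∀ i j, IntegrableOn (fun t => max (-(ρ i * ρ j * A t i j)) 0) (Set.Ioi 0)) :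
    ∃ γ, ∀ i, Tendsto (fun t => x t i) atTop (𝓝 (ρ i * γ)) := by
  obtain ⟨c, hc0, hc⟩ := hx.exists_tendsto_abs_common hA hCB hN hS
  rcases hc0.eq_or_lt with rfl | hc0
  · exact ⟨0, fun i => by simpa using (tendsto_zero_iff_abs_tendsto_zero _).2 (hc i)⟩
  obtain ⟨σ, hσ, hlim, hint'⟩ := hx.exists_limit_sign hA hCB hc0 hc
  refine ⟨σ ⟨0, hN⟩ * ρ ⟨0, hN⟩ * c, fun i => ?_⟩
  have h : σ ⟨0, hN⟩ * ρ ⟨0, hN⟩ = σ i * ρ i :=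
    EssReach.rel (r := fun i j => σ i * ρ i = σ j * ρ j) (fun _ => rfl) (fun _ _ _ => Eq.trans)
      (fun i j h => sign_mul_eq_of_essArc hA hσ hρ hint' hint h) (hS ⟨0, hN⟩ i)
  have h2 : ρ i * ρ i = 1 := by rcases hρ i with h | h <;> simp [h]
  convert hlim i using 2
  rw [h]
  linear_combination σ i * c * h2

end IsSolution

/-- On an essentially balanced graph there is a solution that stays away from zero. -/
theorem exists_isSolution_half_le (hA : IsAdjacency A) (hN : 0 < N) {ρ : Fin N → ℝ}
    (hρ : ∀ i, ρ i = 1 ∨ ρ i = -1)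
    (hint : ∀ i j, IntegrableOn (fun t => max (-(ρ i * ρ j * A t i j)) 0) (Set.Ioi 0)) :
    ∃ x, IsSolution A x ∧ ∃ T, ∀ t, T ≤ t → ∀ i, 1 / 2 ≤ ρ i * x t i := by
  set h : ℝ → ℝ := fun t => ∑ i, ∑ k, 2 * max (-(ρ i * ρ k * A t i k)) 0 with hh
  have hhint : IntegrableOn h (Set.Ioi 0) :=
    integrable_finsetSum _ fun i _ => integrable_finsetSum _ fun k _ => (hint i k).const_mul 2
  obtain ⟨T, hT0, hT⟩ := exists_forall_integral_le hhint (show (0:ℝ) < 1 / 2 by norm_num)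
  obtain ⟨x, hx, hxT⟩ := exists_isSolution hA hT0 ρ
  have hρsq : ∀ i, ρ i * ρ i = 1 := fun i => by rcases hρ i with h | h <;> simp [h]
  have hρabs : ∀ i, |ρ i| = 1 := fun i => by rcases hρ i with h | h <;> simp [h]
  refine ⟨x, hx, T, fun t ht i => ?_⟩
  obtain ⟨L, hL⟩ := hx.lipschitzOnWith hA t
  have hlip : ∀ i ∈ (Finset.univ : Finset (Fin N)),
      LipschitzOnWith L (fun s => -(ρ i * x s i)) (Set.Icc T t) := by
    intro i _
    refine LipschitzOnWith.of_dist_le_mul fun s hs u hu => ?_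
    have := (hL i).dist_le_mul s ⟨hT0.trans hs.1, hs.2⟩ u ⟨hT0.trans hu.1, hu.2⟩
    rwa [dist_neg_neg, Real.dist_eq, ← mul_sub, abs_mul, hρabs, one_mul]
  have hmain := le_add_integral_of_deriv_le_of_isMax (s := Finset.univ)
    (f := fun i s => -(ρ i * x s i)) (m := -1) (h := h) ⟨⟨0, hN⟩, Finset.mem_univ _⟩ ht hlip
    ((intervalIntegrable_iff_integrableOn_Ioc_of_le ht).2
      (hhint.mono_set fun s hs => hT0.trans_lt hs.1)) ?_
    (fun i _ => by simp [hxT, hρsq]) (Finset.mem_univ i)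
  · linarith [hT t ht]
  filter_upwards [hx.ae_hasDerivAt hA] with s hs hsT j _ hmax
  have hy : ∀ k, ρ k * x s k ≤ 1 := fun k => by
    have := hx.abs_le_of_abs_le hA hT0 hsT.1.le (m := 1) (fun i => by rw [hxT, hρabs]) k
    calc ρ k * x s k ≤ |ρ k * x s k| := le_abs_self _
      _ ≤ 1 := by rwa [abs_mul, hρabs, one_mul]
  have hd : HasDerivAt (fun s => -(ρ j * x s j)) _ s :=
    ((hs (hT0.trans_lt hsT.1) j).const_mul (ρ j)).neg
  rw [hd.deriv, Finset.mul_sum, ← Finset.sum_neg_distrib]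
  refine le_trans (Finset.sum_le_sum (g := fun k => 2 * max (-(ρ j * ρ k * A s j k)) 0)
    fun k _ => ?_) (Finset.single_le_sum (f := fun i => ∑ k, 2 * max (-(ρ i * ρ k * A s i k)) 0)
      (fun i _ => Finset.sum_nonneg fun k _ => by positivity) (Finset.mem_univ j))
  have habs : |A s j k| = |ρ j * ρ k * A s j k| := by
    rw [abs_mul, abs_mul, hρabs, hρabs, one_mul, one_mul]
  have hrw : -(ρ j * (A s j k * x s k - |A s j k| * x s j)) =
      |ρ j * ρ k * A s j k| * (ρ j * x s j) - (ρ j * ρ k * A s j k) * (ρ k * x s k) := by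
    rw [← habs]
    linear_combination (ρ j * A s j k * x s k) * hρsq k
  rw [hrw]
  have h1 : ρ j * x s j ≤ ρ k * x s k := neg_le_neg_iff.1 (hmax k (Finset.mem_univ k))
  have h2 := hy j
  have h3 := hy k
  set b := ρ j * ρ k * A s j k
  rcases le_total 0 b with hb | hb
  · rw [abs_of_nonneg hb, max_eq_right (by linarith)]
    nlinarith
  · rw [abs_of_nonpos hb, max_eq_left (by linarith)]
    nlinarith

theorem bipartiteConsensus_of_essStructBal (hA : IsAdjacency A) (hCB : CutBalanced A)
    (hN : 0 < N) (hS : ∀ u v, EssReach A u v) (hbal : EssStructBal A) : BipartiteConsensus A := by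
  classical
  obtain ⟨S, hP, hM⟩ := hbal
  set ρ : Fin N → ℝ := fun i => if i ∈ S then 1 else -1 with hρdef
  have hρS : ∀ i, ρ i = 1 ∧ i ∈ S ∨ ρ i = -1 ∧ i ∉ S := fun i => by
    by_cases h : i ∈ S <;> simp [hρdef, h]
  have hρ : ∀ i, ρ i = 1 ∨ ρ i = -1 := fun i => (hρS i).imp And.left And.left
  have hint := integrableOn_of_essStructBal hA hρS hP hM
  choose z hz hz0 using fun j : Fin N => exists_isSolution hA le_rfl (Pi.single j 1)
  choose v hv using fun j => (hz j).exists_tendsto_sign_mul hA hCB hN hS hρ hint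
  have hlim : ∀ x, IsSolution A x →
      ∀ i, Tendsto (fun t => x t i) atTop (𝓝 (ρ i * ∑ j, v j * x 0 j)) := by
    intro x hx i
    have h1 : Tendsto (fun t => ∑ j, z j t i * x 0 j) atTop (𝓝 (∑ j, ρ i * v j * x 0 j)) :=
      tendsto_finsetSum _ fun j _ => (hv j i).mul_const _
    simp only [mul_assoc] at h1
    rw [Finset.mul_sum]
    refine h1.congr' ?_
    filter_upwards [eventually_ge_atTop 0] with t ht using (hx.eq_sum_of_basis hA hz hz0 ht i).symm
  refine ⟨v, ρ, ?_, hρ, hlim⟩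
  rintro rfl
  obtain ⟨x, hx, T, hT⟩ := exists_isSolution_half_le hA hN hρ hint
  have h0 : Tendsto (fun t => ρ ⟨0, hN⟩ * x t ⟨0, hN⟩) atTop (𝓝 0) := by
    simpa using (hlim x hx ⟨0, hN⟩).const_mul (ρ ⟨0, hN⟩)
  have := ge_of_tendsto h0 (eventually_atTop.2 ⟨T, fun t ht => hT t ht ⟨0, hN⟩⟩)
  norm_num at this

theorem dotProduct_self_pos {v : Fin N → ℝ} (hv : v ≠ 0) : 0 < ∑ j, v j * v j := by
  obtain ⟨i, hi⟩ := Function.ne_iff.1 hv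
  exact Finset.sum_pos' (fun j _ => mul_self_nonneg _)
    ⟨i, Finset.mem_univ i, mul_self_pos.2 hi⟩

/-- The limit signs of a bipartite consensus are compatible with the essential interactions. -/
theorem integrableOn_of_bipartiteConsensus (hA : IsAdjacency A) (hCB : CutBalanced A)
    {v ρ : Fin N → ℝ} (hv : v ≠ 0) (hρ : ∀ i, ρ i = 1 ∨ ρ i = -1)
    (hlim : ∀ x, IsSolution A x →
      ∀ i, Tendsto (fun t => x t i) atTop (𝓝 (ρ i * ∑ j, v j * x 0 j))) (i j : Fin N) :
    IntegrableOn (fun t => max (-(ρ i * ρ j * A t i j)) 0) (Set.Ioi 0) := by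
  obtain ⟨x, hx, hx0⟩ := exists_isSolution hA le_rfl v
  have h := hlim x hx
  rw [hx0] at h
  have hpos := dotProduct_self_pos hv
  obtain ⟨σ, hσ, hσlim, hint⟩ := hx.exists_limit_sign hA hCB hpos fun i => by
    have h1 := (h i).abs
    have h2 : |ρ i| = 1 := by rcases hρ i with h | h <;> simp [h]
    rwa [abs_mul, h2, one_mul, abs_of_pos hpos] at h1
  have heq : σ = ρ := funext fun i =>
    mul_right_cancel₀ hpos.ne' (tendsto_nhds_unique (hσlim i) (h i))
  exact heq ▸ hint i j

theorem polarized_iff (hA : IsAdjacency A) (hS : ∀ u v, EssReach A u v)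
    {ρ : Fin N → ℝ} (hρ : ∀ i, ρ i = 1 ∨ ρ i = -1)
    (hint : ∀ i j, IntegrableOn (fun t => max (-(ρ i * ρ j * A t i j)) 0) (Set.Ioi 0)) :
    (∃ i j, ρ i = 1 ∧ ρ j = -1) ↔ ∃ i j, EssMinus A i j := by
  constructor
  · rintro ⟨i, j, hi, hj⟩
    by_contra! hno
    have h : ρ i = ρ j := by
      refine EssReach.rel (r := fun i j => ρ i = ρ j) (fun _ => rfl) (fun _ _ _ => Eq.trans)
        (fun i j h => ?_) (hS i j)
      rcases sign_mul_eq hρ j i with ⟨_, h1⟩ | ⟨h1, _⟩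
      · exact h1.symm
      · rcases h.essPlus_or_essMinus hA with h2 | h2
        · exact absurd h2 (not_essPlus_of_sign hA (hint j i) h1)
        · exact absurd h2 (hno j i)
    norm_num [hi, hj] at h
  · rintro ⟨i, j, hij⟩
    rcases sign_mul_eq hρ i j with ⟨h, _⟩ | ⟨_, h⟩
    · exact absurd hij (not_essMinus_of_sign hA (hint i j) h)
    · rcases hρ j with h' | h'
      · exact ⟨j, i, h', by rw [h, h']⟩
      · exact ⟨i, j, by rw [h, h', neg_neg], h'⟩

end BipartiteConsensus

section Connectivity

variable {N : ℕ} {A : ℝ → Matrix (Fin N) (Fin N) ℝ} {x : ℝ → Fin N → ℝ}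

/-- Under cut-balance, the essentially incoming interactions of a set are absent as soon as the
essentially outgoing ones are. -/
theorem CutBalanced.integrableOn_cut (hA : IsAdjacency A) (hCB : CutBalanced A)
    {V : Finset (Fin N)} (hV : V.Nonempty) (hV' : V ≠ Finset.univ)
    (h : IntegrableOn (fun t => ∑ j ∈ V, ∑ k ∈ Vᶜ, |A t k j|) (Set.Ioi 0)) :
    IntegrableOn (fun t => ∑ j ∈ V, ∑ k ∈ Vᶜ, |A t j k|) (Set.Ioi 0) := by
  obtain ⟨K, -, hcut⟩ := hCB
  refine Integrable.mono' (h.const_mul K) ?_ ?_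
  · exact (Finset.measurable_fun_sum _ fun j _ => Finset.measurable_fun_sum _ fun k _ =>
      measurable_abs.comp (hA.1 j k)).aestronglyMeasurable
  · filter_upwards [ae_restrict_of_ae_restrict_of_subset Set.Ioi_subset_Ici_self hcut] with t ht
    have h0 : 0 ≤ ∑ j ∈ V, ∑ k ∈ Vᶜ, |A t j k| := by positivity
    exact (Real.norm_of_nonneg h0).le.trans (ht V hV hV').2

/-- A solution vanishing on `W` at time `T` stays small on `W` if `W` has little incoming
interaction after time `T`. -/
theorem IsSolution.abs_le_of_eq_zero_on (hA : IsAdjacency A) (hx : IsSolution A x)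
    {W : Finset (Fin N)} {h : ℝ → ℝ} (hh : IntegrableOn h (Set.Ioi 0))
    (hW : IntegrableOn (fun t => ∑ j ∈ W, ∑ k ∈ Wᶜ, |A t j k|) (Set.Ioi 0))
    (hle : ∀ t, ∑ j ∈ W, ∑ k ∈ Wᶜ, |A t j k| ≤ h t) {T t m ε : ℝ} (hT : 0 ≤ T)
    (hTt : T ≤ t) (hm : ∀ i, |x T i| ≤ m) (hm0 : 0 ≤ m) (h0 : ∀ i ∈ W, x T i = 0)
    (hε : ∫ s in T..t, h s ≤ ε) {i : Fin N} (hi : i ∈ W) : |x t i| ≤ ε * m := by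
  have h1 := hx.abs_le_add_integral hA (W := W) hT hTt (m := m) (m₀ := 0)
    (fun s hs k _ => hx.abs_le_of_abs_le hA hT hs.1 hm k) (fun i hi => by simp [h0 i hi]) hi
  simp only [← Finset.sum_mul, intervalIntegral.integral_mul_const, zero_add] at h1
  refine h1.trans (mul_le_mul_of_nonneg_right (le_trans ?_ hε) hm0)
  have hsub : Set.Ioc T t ⊆ Set.Ioi 0 := fun s hs => hT.trans_lt hs.1
  exact intervalIntegral.integral_mono hTt
    ((intervalIntegrable_iff_integrableOn_Ioc_of_le hTt).2 (hW.mono_set hsub))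
    ((intervalIntegrable_iff_integrableOn_Ioc_of_le hTt).2 (hh.mono_set hsub)) hle

theorem essReach_of_bipartiteConsensus (hA : IsAdjacency A) (hCB : CutBalanced A)
    {v ρ : Fin N → ℝ} (hv : v ≠ 0) (hρ : ∀ i, ρ i = 1 ∨ ρ i = -1)
    (hlim : ∀ x, IsSolution A x →
      ∀ i, Tendsto (fun t => x t i) atTop (𝓝 (ρ i * ∑ j, v j * x 0 j))) (u w : Fin N) :
    EssReach A u w := by
  classical
  by_contra huw
  set V : Finset (Fin N) := Finset.univ.filter (EssReach A u) with hVdef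
  have hu : u ∈ V := Finset.mem_filter.2 ⟨Finset.mem_univ u, Relation.ReflTransGen.refl⟩
  have hw : w ∈ Vᶜ := by simpa [hVdef] using huw
  have hout : IntegrableOn (fun t => ∑ j ∈ V, ∑ k ∈ Vᶜ, |A t k j|) (Set.Ioi 0) := by
    refine integrable_finsetSum _ fun j hj => integrable_finsetSum _ fun k hk => ?_
    by_contra hjk
    rw [Finset.mem_compl] at hk
    exact hk (Finset.mem_filter.2 ⟨Finset.mem_univ k,
      (Finset.mem_filter.1 hj).2.tail ((essArc_iff hA k j).2 hjk)⟩)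
  have hin := hCB.integrableOn_cut hA ⟨u, hu⟩
    (fun h => Finset.mem_compl.1 hw (h ▸ Finset.mem_univ w)) hout
  have hswap : ∀ t, ∑ j ∈ Vᶜ, ∑ k ∈ Vᶜᶜ, |A t j k| = ∑ j ∈ V, ∑ k ∈ Vᶜ, |A t k j| := fun t => by
    rw [compl_compl, Finset.sum_comm]
  have hout' : IntegrableOn (fun t => ∑ j ∈ Vᶜ, ∑ k ∈ Vᶜᶜ, |A t j k|) (Set.Ioi 0) := by
    simpa only [hswap] using hout
  have hnonneg : ∀ (W : Finset (Fin N)) t, 0 ≤ ∑ j ∈ W, ∑ k ∈ Wᶜ, |A t j k| := fun W t => by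
    positivity
  have hpos := dotProduct_self_pos hv
  set s := ∑ j, v j * v j
  set M := ∑ j, |v j|
  have hM0 : 0 ≤ M := Finset.sum_nonneg fun j _ => abs_nonneg _
  set ε := s / (2 * M + 1) with hε
  have hε0 : 0 < ε := by positivity
  have hεM : ε * (2 * M + 1) = s := div_mul_cancel₀ _ (by positivity)
  obtain ⟨T, hT0, hT⟩ := exists_forall_integral_le (hin.add hout') hε0
  obtain ⟨x, hx, hx0⟩ := exists_isSolution hA le_rfl v
  have hxM : ∀ i, |x T i| ≤ M := hx.abs_le_of_abs_le hA le_rfl hT0 fun i => by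
    rw [hx0]
    exact Finset.single_le_sum (f := fun j => |v j|) (fun j _ => abs_nonneg _) (Finset.mem_univ i)
  obtain ⟨y, hy, hyT⟩ := exists_isSolution hA hT0 fun i => if i ∈ V then x T i else 0
  have hz := hx.sub hA hy
  have hyM : ∀ i, |y T i| ≤ M := fun i => by
    rw [hyT]
    by_cases h : i ∈ V <;> simp [h, hxM, hM0]
  have hzM : ∀ i, |(x - y) T i| ≤ M := fun i => by
    rw [Pi.sub_apply, Pi.sub_apply, hyT]
    by_cases h : i ∈ V <;> simp [h, hxM, hM0]
  have hlim_le : ∀ {z : ℝ → Fin N → ℝ} {i : Fin N}, IsSolution A z →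
      (∀ t, T ≤ t → |z t i| ≤ ε * M) → |∑ j, v j * z 0 j| ≤ ε * M := by
    intro z i hz hle
    have h1 := (hlim z hz i).abs
    have h2 : |ρ i| = 1 := by rcases hρ i with h | h <;> simp [h]
    rw [abs_mul, h2, one_mul] at h1
    exact le_of_tendsto h1 (eventually_atTop.2 ⟨T, hle⟩)
  have h1 : |∑ j, v j * y 0 j| ≤ ε * M := hlim_le (i := w) hy fun t ht =>
    hy.abs_le_of_eq_zero_on hA (hin.add hout') hout' (fun t => le_add_of_nonneg_left (hnonneg V t))
      hT0 ht hyM hM0 (fun i hi => by simp [hyT, Finset.mem_compl.1 hi]) (hT t ht) hw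
  have h2 : |∑ j, v j * (x - y) 0 j| ≤ ε * M := hlim_le (i := u) hz fun t ht =>
    hz.abs_le_of_eq_zero_on hA (hin.add hout') hin
      (fun t => le_add_of_nonneg_right (hnonneg Vᶜ t))
      hT0 ht hzM hM0 (fun i hi => by simp [hyT, hi]) (hT t ht) hu
  have h3 : ∑ j, v j * (x - y) 0 j = s - ∑ j, v j * y 0 j := by
    simp only [Pi.sub_apply, hx0, mul_sub, Finset.sum_sub_distrib, s]
  rw [h3] at h2
  linarith [(abs_le.1 h1).2, (abs_le.1 h2).2]

end Connectivity

/-- for cut-balanced graphs, bipartite consensus holds iff `ℰ⁺ ∩ ℰ⁻ = ∅` and the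
essential signed graph is strongly connected and structurally balanced; in that case the
opinions polarize iff `ℰ⁻ ≠ ∅` (otherwise consensus); and if the essential graph is strongly
connected but `ℰ⁺ ∩ ℰ⁻ ≠ ∅` or the essential signed graph is unbalanced, every solution
converges to 0. -/
theorem stmt17 {N : ℕ} (hN : 2 ≤ N) (A : ℝ → Matrix (Fin N) (Fin N) ℝ)
    (hA : IsAdjacency A) (hCB : CutBalanced A) :
    (BipartiteConsensus A ↔
      ((∀ i j : Fin N, ¬(EssPlus A i j ∧ EssMinus A i j)) ∧
       (∀ u v : Fin N, EssReach A u v) ∧ EssStructBal A)) ∧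
    (((∀ i j : Fin N, ¬(EssPlus A i j ∧ EssMinus A i j)) ∧
       (∀ u v : Fin N, EssReach A u v) ∧ EssStructBal A) →
      ∀ v ρ : Fin N → ℝ, v ≠ 0 → (∀ i, ρ i = 1 ∨ ρ i = -1) →
        (∀ x : ℝ → Fin N → ℝ, IsSolution A x →
          ∀ i, Tendsto (fun t => x t i) atTop (𝓝 (ρ i * ∑ j, v j * x 0 j))) →
        ((∃ i j, ρ i = 1 ∧ ρ j = -1) ↔ ∃ i j : Fin N, EssMinus A i j)) ∧
    (((∀ u v : Fin N, EssReach A u v) ∧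
        ((∃ i j : Fin N, EssPlus A i j ∧ EssMinus A i j) ∨ ¬ EssStructBal A)) →
      ∀ x : ℝ → Fin N → ℝ, IsSolution A x →
        ∀ i, Tendsto (fun t => x t i) atTop (𝓝 0)) := by
  have hN0 : 0 < N := by lia
  refine ⟨⟨?_, ?_⟩, ?_, ?_⟩
  · rintro ⟨v, ρ, hv, hρ, hlim⟩
    have hint := integrableOn_of_bipartiteConsensus hA hCB hv hρ hlim
    refine ⟨fun i j ⟨hp, hm⟩ => ?_, essReach_of_bipartiteConsensus hA hCB hv hρ hlim,
      essStructBal_of_sign hA hρ hint⟩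
    rcases sign_mul_eq hρ i j with ⟨h, _⟩ | ⟨h, _⟩
    · exact not_essMinus_of_sign hA (hint i j) h hm
    · exact not_essPlus_of_sign hA (hint i j) h hp
  · rintro ⟨-, hS, hbal⟩
    exact bipartiteConsensus_of_essStructBal hA hCB hN0 hS hbal
  · rintro ⟨-, hS, -⟩ v ρ hv hρ hlim
    exact polarized_iff hA hS hρ (integrableOn_of_bipartiteConsensus hA hCB hv hρ hlim)
  · rintro ⟨hS, hunb⟩ x hx i
    exact hx.tendsto_zero_of_not_essStructBal hA hCB hN0 hS hunb i
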